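/- arXiv:1504.03591 — 9 statements merged into one kernel-verified Lean document; each statement's English description precedes it below -/
import Mathlib

section
/- Let k ≥ 2 be an integer, let f ∈ C₊(ℝ), and let a < b be real numbers. If there exists a polynomial p with complex coefficients and deg p ≤ k−1 such that f(x) = p(x) for all x ∈ (a,b), then there exists a polynomial q with complex coefficients and deg q ≤ k−1 such that x·f(x) − k·∫₀ˣ f(t) dt = q(x) for all x ∈ (a,b). -/
open Polynomial in
theorem Polynomial.exists_derivative_eq {K : Type*} [Field K] [CharZero K] (p : K[X]) :
    ∃ P : K[X], derivative P = p := by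
  induction p using Polynomial.induction_on' with
  | add p q hp hq =>
    obtain ⟨P, rfl⟩ := hp
    obtain ⟨Q, rfl⟩ := hq
    exact ⟨P + Q, derivative_add⟩
  | monomial n a =>
    refine ⟨monomial (n + 1) (a / (n + 1)), ?_⟩
    have : (n + 1 : K) ≠ 0 := by exact_mod_cast n.succ_ne_zero
    rw [derivative_monomial]
    simp [div_mul_cancel₀ a this]

open Polynomial in
/-- The top coefficients of `X * P'` and `k * P` cancel when `P'` has degree at most `k - 1`. -/
theorem Polynomial.degree_X_mul_derivative_sub_le {R : Type*} [CommRing R] [IsDomain R]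
    [CharZero R] {k : ℕ} (hk : 0 < k) {P : R[X]}
    (hP : (derivative P).degree ≤ (k - 1 : ℕ)) :
    degree (X * derivative P - C (k : R) * P) ≤ (k - 1 : ℕ) := by
  rw [degree_le_iff_coeff_zero]
  intro n hn
  have hn' : k - 1 < n := by exact_mod_cast hn
  obtain ⟨j, rfl⟩ : ∃ j, n = j + 1 := ⟨n - 1, by omega⟩
  rw [coeff_sub, coeff_X_mul, coeff_C_mul]
  have hj := coeff_derivative P j
  rcases (show k = j + 1 ∨ k - 1 < j by omega) with rfl | hlt
  · rw [hj]; push_cast; ring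
  · have h0 : (derivative P).coeff j = 0 :=
      coeff_eq_zero_of_degree_lt (hP.trans_lt (by exact_mod_cast hlt))
    have hne : (j + 1 : R) ≠ 0 := by exact_mod_cast j.succ_ne_zero
    rw [h0] at hj ⊢
    rw [(mul_eq_zero.mp hj.symm).resolve_right hne]
    simp

/-- If `W = f/H^k` vanishes on `(a,b)` (i.e. `f` agrees with a polynomial of degree
`≤ k-1` there), then `xW` vanishes on `(a,b)`. -/
theorem stmt0 (k : ℕ) (hk : 2 ≤ k) (f : ℝ → ℂ) (hf : Continuous f)
    (hf0 : ∀ x : ℝ, x < 0 → f x = 0) (a b : ℝ) (hab : a < b)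
    (h : ∃ p : Polynomial ℂ, p.degree ≤ (k - 1 : ℕ) ∧
      ∀ x ∈ Set.Ioo a b, f x = p.eval (x : ℂ)) :
    ∃ q : Polynomial ℂ, q.degree ≤ (k - 1 : ℕ) ∧
      ∀ x ∈ Set.Ioo a b,
        (x : ℂ) * f x - (k : ℂ) * ∫ t in (0:ℝ)..x, f t = q.eval (x : ℂ) := by
  obtain ⟨p, hp, hfp⟩ := h
  obtain ⟨P, rfl⟩ := p.exists_derivative_eq
  obtain ⟨m, hm⟩ := Set.nonempty_Ioo.mpr hab
  refine ⟨Polynomial.X * Polynomial.derivative P - Polynomial.C (k : ℂ) * P +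
    Polynomial.C (k * (P.eval (m : ℂ) - ∫ t in (0:ℝ)..m, f t)), ?_, ?_⟩
  · refine (Polynomial.degree_add_le _ _).trans (max_le ?_ ?_)
    · exact Polynomial.degree_X_mul_derivative_sub_le (by omega) hp
    · exact Polynomial.degree_C_le.trans (by exact_mod_cast Nat.zero_le _)
  · intro x hx
    have hsub : Set.uIcc m x ⊆ Set.Ioo a b := Set.ordConnected_Ioo.uIcc_subset hm hx
    have hint : ∫ t in m..x, f t = P.eval (x : ℂ) - P.eval (m : ℂ) := by
      refine intervalIntegral.integral_eq_sub_of_hasDerivAt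
        (f := fun t : ℝ => P.eval (t : ℂ)) (fun t ht => ?_) (hf.intervalIntegrable _ _)
      rw [hfp t (hsub ht)]
      exact (P.hasDerivAt (t : ℂ)).comp_ofReal
    rw [← intervalIntegral.integral_add_adjacent_intervals
      (hf.intervalIntegrable 0 m) (hf.intervalIntegrable m x), hint, hfp x hx]
    simp only [Polynomial.eval_add, Polynomial.eval_sub, Polynomial.eval_mul,
      Polynomial.eval_X, Polynomial.eval_C]
    ring
end

section
/- Let k ≥ 2 be an integer, let f ∈ C₊(ℝ), and let 0 ≤ a < b be real numbers. If there exists a polynomial p with complex coefficients and deg p ≤ k−1 such that x·f(x) − k·∫₀ˣ f(t) dt = p(x) for all x ∈ (a,b), then there exists a polynomial q with complex coefficients and deg q ≤ k−1 such that f(x) = q(x) for all x ∈ (a,b). -/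
open Polynomial in
/-- The operator `P ↦ X * P' - (n + 1) * P` maps the polynomials of degree at most `n`
onto themselves. -/
theorem exists_X_mul_derivative_sub_eq (n : ℕ) (p : ℂ[X]) (hp : p.degree ≤ n) :
    ∃ P : ℂ[X], P.degree ≤ n ∧ X * derivative P - C ((n + 1 : ℕ) : ℂ) * P = p := by
  refine ⟨∑ j ∈ Finset.range (n + 1), monomial j (p.coeff j / ((j : ℂ) - (n + 1 : ℕ))), ?_, ?_⟩
  · refine (degree_sum_le _ _).trans (Finset.sup_le fun j hj => ?_)
    exact (degree_monomial_le _ _).trans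
      (Nat.cast_le.2 (Nat.lt_succ_iff.1 (Finset.mem_range.1 hj)))
  · rw [derivative_sum, Finset.mul_sum, Finset.mul_sum, ← Finset.sum_sub_distrib]
    conv_rhs => rw [p.as_sum_range' (n + 1) (Nat.lt_succ_of_le (natDegree_le_of_degree_le hp))]
    refine Finset.sum_congr rfl fun j hj => ?_
    have hjn : (j : ℂ) - (n + 1 : ℕ) ≠ 0 :=
      sub_ne_zero.2 (Nat.cast_injective.ne (Finset.mem_range.1 hj).ne)
    have hX : ∀ r : ℂ, X * derivative (monomial j r) = monomial j (r * j) := by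
      intro r
      rcases j with _ | m
      · simp
      · rw [derivative_monomial, X_mul_monomial, Nat.add_sub_cancel]
    rw [hX, C_mul_monomial, ← map_sub]
    congr 1
    field_simp

/-- On an interval of positive reals, the solutions of `x * G' = k * G` are the multiples
of `x ^ k`. -/
theorem exists_eq_const_mul_pow_of_mul_deriv_eq (k : ℕ) {a b : ℝ} (ha : 0 ≤ a) {G G' : ℝ → ℂ}
    (hG : ∀ x ∈ Set.Ioo a b, HasDerivAt G (G' x) x)
    (hode : ∀ x ∈ Set.Ioo a b, (x : ℂ) * G' x = k * G x) :
    ∃ c : ℂ, ∀ x ∈ Set.Ioo a b, G x = c * (x : ℂ) ^ k := by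
  have hx0 : ∀ x ∈ Set.Ioo a b, (x : ℂ) ≠ 0 := fun x hx =>
    Complex.ofReal_ne_zero.2 (ha.trans_lt hx.1).ne'
  have hder : ∀ x ∈ Set.Ioo a b, HasDerivAt (fun y : ℝ => G y / (y : ℂ) ^ k) 0 x := by
    intro x hx
    have hne := hx0 x hx
    refine ((hG x hx).fun_div ((hasDerivAt_id x).ofReal_comp.fun_pow k)
      (pow_ne_zero k hne)).congr_deriv ?_
    rw [div_eq_zero_iff]
    left
    rcases k with _ | n
    · have := hode x hx
      simp_all
    · have := hode x hx
      simp only [id, Nat.add_sub_cancel, Complex.ofReal_one]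
      linear_combination (x : ℂ) ^ n * this
  obtain ⟨c, hc⟩ := isOpen_Ioo.exists_is_const_of_deriv_eq_zero isPreconnected_Ioo
    (fun x hx => (hder x hx).differentiableAt.differentiableWithinAt)
    (fun x hx => (hder x hx).deriv)
  exact ⟨c, fun x hx => (div_eq_iff (pow_ne_zero k (hx0 x hx))).1 (hc x hx)⟩

/-- If `xW` vanishes on an interval `(a,b)` with `0 ≤ a`, then `W = f/H^k`
vanishes on `(a,b)`. -/
theorem stmt1 (k : ℕ) (hk : 2 ≤ k) (f : ℝ → ℂ) (hf : Continuous f)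
    (hf0 : ∀ x : ℝ, x < 0 → f x = 0) (a b : ℝ) (ha : 0 ≤ a) (hab : a < b)
    (h : ∃ p : Polynomial ℂ, p.degree ≤ (k - 1 : ℕ) ∧
      ∀ x ∈ Set.Ioo a b,
        (x : ℂ) * f x - (k : ℂ) * ∫ t in (0:ℝ)..x, f t = p.eval (x : ℂ)) :
    ∃ q : Polynomial ℂ, q.degree ≤ (k - 1 : ℕ) ∧
      ∀ x ∈ Set.Ioo a b, f x = q.eval (x : ℂ) := by
  obtain ⟨p, hp, hpf⟩ := h
  obtain ⟨n, rfl⟩ : ∃ n, k = n + 1 := ⟨k - 1, by omega⟩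
  rw [Nat.add_sub_cancel] at *
  obtain ⟨P, hPdeg, hP⟩ := exists_X_mul_derivative_sub_eq n p hp
  have hPeval : ∀ x : ℂ, x * P.derivative.eval x - (n + 1 : ℕ) * P.eval x = p.eval x := by
    intro x
    simp [← hP]
  obtain ⟨c, hc⟩ := exists_eq_const_mul_pow_of_mul_deriv_eq (n + 1) ha (b := b)
    (G := fun x => (∫ t in (0:ℝ)..x, f t) - P.eval (x : ℂ))
    (G' := fun x => f x - P.derivative.eval (x : ℂ))
    (fun x _ => (hf.integral_hasStrictDerivAt 0 x).hasDerivAt.sub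
      (P.hasDerivAt (x : ℂ)).comp_ofReal)
    (fun x hx => by linear_combination hpf x hx - hPeval x)
  refine ⟨P.derivative + Polynomial.C ((n + 1 : ℕ) * c) * Polynomial.X ^ n, ?_, fun x hx => ?_⟩
  · refine (Polynomial.degree_add_le _ _).trans (max_le ?_ (Polynomial.degree_C_mul_X_pow_le _ _))
    exact Polynomial.degree_derivative_le.trans hPdeg
  · have hne : (x : ℂ) ≠ 0 := Complex.ofReal_ne_zero.2 (ha.trans_lt hx.1).ne'
    apply mul_left_cancel₀ hne
    simp only [Polynomial.eval_add, Polynomial.eval_mul, Polynomial.eval_C, Polynomial.eval_pow,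
      Polynomial.eval_X]
    linear_combination hpf x hx - hPeval x + (n + 1 : ℕ) * hc x hx
end

section
/- Let k ≥ 2 be an integer, let f ∈ C₊(ℝ), and let a < 0 < b be real numbers. If there exists a polynomial p with complex coefficients and deg p ≤ k−1 such that x·f(x) − k·∫₀ˣ f(t) dt = p(x) for all x ∈ (a,b), then there exists A ∈ ℂ such that f(x) = A·x^{k−1} for all x ∈ (0,b). -/
/-- A polynomial vanishing on a nondegenerate real interval is zero. -/
lemma Polynomial.eq_zero_of_eval_ofReal_Ioo {p : Polynomial ℂ} {a b : ℝ} (hab : a < b)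
    (hp : ∀ x ∈ Set.Ioo a b, p.eval (x : ℂ) = 0) : p = 0 := by
  refine Polynomial.eq_zero_of_infinite_isRoot p (Set.Infinite.mono ?_
    ((Set.Ioo_infinite hab).image Complex.ofReal_injective.injOn))
  rintro _ ⟨x, hx, rfl⟩
  exact hp x hx

/-- The Euler equation `x F' = k F` on `(0,b)` forces `F` to be a multiple of `x ^ k`. -/
lemma exists_eq_mul_pow_of_euler_equation {F f : ℝ → ℂ} {b : ℝ} (k : ℕ)
    (hF : ∀ x ∈ Set.Ioo 0 b, HasDerivAt F (f x) x)
    (h : ∀ x ∈ Set.Ioo 0 b, (x : ℂ) * f x = k * F x) :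
    ∃ C : ℂ, ∀ x ∈ Set.Ioo 0 b, F x = C * (x : ℂ) ^ k := by
  have hd : ∀ x ∈ Set.Ioo 0 b, HasDerivAt (fun y : ℝ => F y / (y : ℂ) ^ k) 0 x := by
    intro x hx
    have hx0 : (x : ℂ) ≠ 0 := Complex.ofReal_ne_zero.2 hx.1.ne'
    have hpow : HasDerivAt (fun y : ℝ => (y : ℂ) ^ k) (k * (x : ℂ) ^ (k - 1)) x :=
      (hasDerivAt_pow k (x : ℂ)).comp_ofReal
    refine ((hF x hx).div hpow (pow_ne_zero k hx0)).congr_deriv ?_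
    rw [div_eq_zero_iff]
    left
    rcases k with _ | n
    · simpa [hx0] using h x hx
    · rw [Nat.add_sub_cancel, pow_succ]
      linear_combination (x : ℂ) ^ n * h x hx
  obtain ⟨C, hC⟩ := isOpen_Ioo.exists_is_const_of_deriv_eq_zero isPreconnected_Ioo
    (fun x hx => (hd x hx).differentiableAt.differentiableWithinAt)
    (fun x hx => (hd x hx).deriv)
  exact ⟨C, fun x hx =>
    (div_eq_iff (pow_ne_zero k (Complex.ofReal_ne_zero.2 hx.1.ne'))).1 (hC x hx)⟩

/-- If `xW` vanishes on an interval `(a,b)` containing `0`, then `W = f/H^k`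
vanishes on `(0,b)`; more precisely `f(x) = A x^(k-1)` there. -/
theorem stmt2 (k : ℕ) (hk : 2 ≤ k) (f : ℝ → ℂ) (hf : Continuous f)
    (hf0 : ∀ x : ℝ, x < 0 → f x = 0) (a b : ℝ) (ha : a < 0) (hb : 0 < b)
    (h : ∃ p : Polynomial ℂ, p.degree ≤ (k - 1 : ℕ) ∧
      ∀ x ∈ Set.Ioo a b,
        (x : ℂ) * f x - (k : ℂ) * ∫ t in (0:ℝ)..x, f t = p.eval (x : ℂ)) :
    ∃ A : ℂ, ∀ x ∈ Set.Ioo (0:ℝ) b, f x = A * (x : ℂ) ^ (k - 1) := by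
  obtain ⟨p, -, hp⟩ := h
  have hint : ∀ x < 0, ∫ t in (0:ℝ)..x, f t = 0 := by
    intro x hx
    rw [intervalIntegral.integral_symm, intervalIntegral.integral_of_le hx.le,
      MeasureTheory.integral_Ioc_eq_integral_Ioo,
      MeasureTheory.setIntegral_eq_zero_of_forall_eq_zero fun t ht => hf0 t ht.2, neg_zero]
  have hp0 : p = 0 := Polynomial.eq_zero_of_eval_ofReal_Ioo ha fun x hx => by
    rw [← hp x ⟨hx.1, hx.2.trans hb⟩, hf0 x hx.2, hint x hx.2]
    simp
  have heuler : ∀ x ∈ Set.Ioo 0 b, (x : ℂ) * f x = k * ∫ t in (0:ℝ)..x, f t := by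
    intro x hx
    simpa [hp0, sub_eq_zero] using hp x ⟨ha.trans hx.1, hx.2⟩
  obtain ⟨C, hC⟩ := exists_eq_mul_pow_of_euler_equation k
    (fun x _ => hf.integral_hasStrictDerivAt 0 x |>.hasDerivAt) heuler
  refine ⟨k * C, fun x hx => mul_left_cancel₀ (Complex.ofReal_ne_zero.2 hx.1.ne') ?_⟩
  rw [heuler x hx, hC x hx, ← pow_sub_one_mul (by omega : k ≠ 0) (x : ℂ)]
  ring
end

section
/- Let k ≥ 2 be an integer and let f ∈ C₊(ℝ). If there exists a polynomial p with complex coefficients and deg p ≤ k−1 such that x·f(x) − k·∫₀ˣ f(t) dt = p(x) for all x ∈ ℝ, then there exists β ∈ ℂ such that f(x) = β·x^{k−1} for all x ≥ 0. -/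
/-- A complex polynomial vanishing on the negative reals is zero. -/
theorem Polynomial.eq_zero_of_eval_neg_real (p : Polynomial ℂ)
    (hp : ∀ x : ℝ, x < 0 → p.eval (x : ℂ) = 0) : p = 0 := by
  refine p.eq_zero_of_infinite_isRoot (Set.Infinite.mono ?_
    ((Set.Iio_infinite (0 : ℝ)).image Complex.ofReal_injective.injOn))
  rintro _ ⟨x, hx, rfl⟩
  exact hp x hx

/-- On the positive reals, the solutions of Euler's equation `x F'(x) = k F(x)` are the multiples
of `x ^ k`. -/
theorem eq_mul_pow_of_mul_deriv_eq (k : ℕ) (F f : ℝ → ℂ)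
    (hF : ∀ x : ℝ, 0 < x → HasDerivAt F (f x) x)
    (h : ∀ x : ℝ, 0 < x → (x : ℂ) * f x = k * F x) {x : ℝ} (hx : 0 < x) :
    F x = F 1 * (x : ℂ) ^ k := by
  have hG : ∀ y : ℝ, 0 < y → HasDerivAt (fun y : ℝ ↦ F y / (y : ℂ) ^ k) 0 y := by
    intro y hy
    have hy0 : (y : ℂ) ≠ 0 := by exact_mod_cast hy.ne'
    have hpow : HasDerivAt (fun y : ℝ ↦ (y : ℂ) ^ k) (k * (y : ℂ) ^ (k - 1)) y :=
      (hasDerivAt_pow k (y : ℂ)).comp_ofReal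
    refine ((hF y hy).div hpow (pow_ne_zero k hy0)).congr_deriv ?_
    refine div_eq_zero_iff.mpr (Or.inl ?_)
    rcases k with _ | k
    · have := h y hy
      simp_all
    · rw [Nat.add_sub_cancel, pow_succ]
      linear_combination (y : ℂ) ^ k * h y hy
  have hconst := isOpen_Ioi.is_const_of_deriv_eq_zero isPreconnected_Ioi
    (fun y hy ↦ (hG y hy).differentiableAt.differentiableWithinAt)
    (fun y hy ↦ (hG y hy).deriv) (Set.mem_Ioi.mpr hx) (Set.mem_Ioi.mpr one_pos)
  have hx0 : (x : ℂ) ^ k ≠ 0 := pow_ne_zero k (by exact_mod_cast hx.ne')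
  simpa [div_eq_iff hx0] using hconst

/-- If `xW = 0` on `(-∞,∞)` for `W = f/H^k`, then `f(x) = β x^(k-1)` for `x ≥ 0`
(so that `W` is a multiple of the Dirac delta). -/
theorem stmt3 (k : ℕ) (hk : 2 ≤ k) (f : ℝ → ℂ) (hf : Continuous f)
    (hf0 : ∀ x : ℝ, x < 0 → f x = 0)
    (h : ∃ p : Polynomial ℂ, p.degree ≤ (k - 1 : ℕ) ∧
      ∀ x : ℝ,
        (x : ℂ) * f x - (k : ℂ) * ∫ t in (0:ℝ)..x, f t = p.eval (x : ℂ)) :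
    ∃ β : ℂ, ∀ x : ℝ, 0 ≤ x → f x = β * (x : ℂ) ^ (k - 1) := by
  obtain ⟨p, -, hp⟩ := h
  have hf0' : ∀ x ≤ 0, f x = 0 := by
    have hcl := (isClosed_eq hf continuous_const).closure_subset_iff.mpr
      (show Set.Iio (0 : ℝ) ⊆ {x | f x = 0} from hf0)
    rw [closure_Iio] at hcl
    exact fun x hx ↦ hcl hx
  have hp0 : p = 0 := p.eq_zero_of_eval_neg_real fun x hx ↦ by
    have hint : ∫ t in (0:ℝ)..x, f t = 0 := by
      rw [intervalIntegral.integral_congr (g := fun _ ↦ (0 : ℂ)), intervalIntegral.integral_zero]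
      intro t ht
      rw [Set.uIcc_of_ge hx.le] at ht
      exact hf0' t ht.2
    rw [← hp x, hint, hf0 x hx]
    simp
  have heuler : ∀ x : ℝ, (x : ℂ) * f x = k * ∫ t in (0:ℝ)..x, f t := fun x ↦ by
    simpa [hp0, sub_eq_zero] using hp x
  refine ⟨k * ∫ t in (0:ℝ)..1, f t, fun x hx ↦ ?_⟩
  rcases hx.eq_or_lt with rfl | hx
  · simp [hf0' 0 le_rfl, show k - 1 ≠ 0 by lia]
  · have hx0 : (x : ℂ) ≠ 0 := by exact_mod_cast hx.ne'
    have hsol := eq_mul_pow_of_mul_deriv_eq k (fun x ↦ ∫ t in (0:ℝ)..x, f t) f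
      (fun y _ ↦ hf.integral_hasStrictDerivAt 0 y |>.hasDerivAt) (fun y _ ↦ heuler y) hx
    apply mul_left_cancel₀ hx0
    rw [heuler x, hsol, ← mul_pow_sub_one (show k ≠ 0 by lia) (x : ℂ)]
    ring
end

section
/- Let g : ℝ → ℂ be continuous with g(x) = 0 for all x < 0, let β > −1 be real, and let c ∈ ℂ. If g(x)/x^β → c as x → ∞, then (1/x^{β+1})·∫₀ˣ g(t) dt → c/(β+1) as x → ∞. -/
/-- If `u` is integrable on bounded intervals and `u(t) = o(t^β)` at infinity, `β > -1`, then
`∫₀ˣ u = o(x^(β+1))`. -/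
theorem isLittleO_integral_rpow_add_one {E : Type*} [NormedAddCommGroup E] [NormedSpace ℝ E]
    {u : ℝ → E} {β : ℝ} (hβ : -1 < β)
    (hu : ∀ a b : ℝ, IntervalIntegrable u MeasureTheory.volume a b)
    (h : u =o[Filter.atTop] fun t : ℝ => t ^ β) :
    (fun x : ℝ => ∫ t in (0:ℝ)..x, u t) =o[Filter.atTop] fun x : ℝ => x ^ (β + 1) := by
  have hβ' : 0 < β + 1 := by linarith
  rw [Asymptotics.isLittleO_iff]
  intro ε hε
  obtain ⟨A₀, hA₀⟩ := Filter.eventually_atTop.1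
    (h.def (show 0 < ε / 2 * (β + 1) by positivity))
  set A := max A₀ 1
  have hA : 0 < A := lt_of_lt_of_le one_pos (le_max_right _ _)
  filter_upwards [(tendsto_rpow_atTop hβ').eventually_ge_atTop
    (‖∫ t in (0:ℝ)..A, u t‖ / (ε / 2)), Filter.eventually_ge_atTop A] with x hx hAx
  have hx0 : 0 < x := hA.trans_le hAx
  have head : ‖∫ t in (0:ℝ)..A, u t‖ ≤ ε / 2 * x ^ (β + 1) := by
    rwa [div_le_iff₀' (by positivity)] at hx
  have tail : ‖∫ t in A..x, u t‖ ≤ ε / 2 * x ^ (β + 1) :=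
    calc ‖∫ t in A..x, u t‖ ≤ ∫ t in A..x, ε / 2 * (β + 1) * t ^ β := by
          refine intervalIntegral.norm_integral_le_of_norm_le hAx (.of_forall fun t ht => ?_)
            ((intervalIntegral.intervalIntegrable_rpow' hβ).const_mul _)
          have := hA₀ t ((le_max_left _ _).trans ht.1.le)
          rwa [Real.norm_of_nonneg (Real.rpow_nonneg (hA.trans ht.1).le _)] at this
      _ = ε / 2 * (x ^ (β + 1) - A ^ (β + 1)) := by
          rw [intervalIntegral.integral_const_mul, integral_rpow (.inl hβ)]
          field_simp
      _ ≤ ε / 2 * x ^ (β + 1) := by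
          gcongr
          exact sub_le_self _ (by positivity)
  rw [← intervalIntegral.integral_add_adjacent_intervals (hu 0 A) (hu A x),
    Real.norm_of_nonneg (by positivity : 0 ≤ x ^ (β + 1))]
  linarith [norm_add_le (∫ t in (0:ℝ)..A, u t) (∫ t in A..x, u t)]

/-- If `g(x)/x^β → c` as `x → ∞` with `β > -1`, then
`(1/x^(β+1)) ∫₀ˣ g → c/(β+1)`. -/
theorem stmt4 (g : ℝ → ℂ) (hg : Continuous g) (hg0 : ∀ x : ℝ, x < 0 → g x = 0)
    (β : ℝ) (hβ : -1 < β) (c : ℂ)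
    (h : Filter.Tendsto (fun x : ℝ => g x / ((x ^ β : ℝ) : ℂ)) Filter.atTop (nhds c)) :
    Filter.Tendsto (fun x : ℝ => (∫ t in (0:ℝ)..x, g t) / ((x ^ (β + 1) : ℝ) : ℂ))
      Filter.atTop (nhds (c / ((β : ℂ) + 1))) := by
  have hβ' : (β : ℂ) + 1 ≠ 0 := by
    exact_mod_cast (by linarith : 0 < β + 1).ne'
  have hpow (a b : ℝ) :
      IntervalIntegrable (fun t : ℝ => c * ((t ^ β : ℝ) : ℂ)) MeasureTheory.volume a b := by
    have hi := intervalIntegral.intervalIntegrable_rpow' (a := a) (b := b) hβ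
    exact IntervalIntegrable.const_mul ⟨hi.1.ofReal, hi.2.ofReal⟩ c
  have hgi (a b : ℝ) : IntervalIntegrable g MeasureTheory.volume a b := hg.intervalIntegrable a b
  have hu : (fun t : ℝ => g t - c * ((t ^ β : ℝ) : ℂ)) =o[Filter.atTop] fun t : ℝ => t ^ β := by
    rw [← Asymptotics.isLittleO_norm_right]
    simp_rw [← Complex.norm_real]
    rw [Asymptotics.isLittleO_norm_right, Asymptotics.isLittleO_iff_tendsto']
    · refine (sub_self c ▸ h.sub_const c).congr' ?_
      filter_upwards [Filter.eventually_gt_atTop 0] with t ht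
      have : ((t ^ β : ℝ) : ℂ) ≠ 0 := Complex.ofReal_ne_zero.2 (Real.rpow_pos_of_pos ht β).ne'
      field_simp
    · filter_upwards [Filter.eventually_gt_atTop 0] with t ht h0
      exact absurd h0 (Complex.ofReal_ne_zero.2 (Real.rpow_pos_of_pos ht β).ne')
  have hint := isLittleO_integral_rpow_add_one hβ (fun a b => (hgi a b).sub (hpow a b)) hu
  rw [← Asymptotics.isLittleO_norm_right] at hint
  simp_rw [← Complex.norm_real] at hint
  rw [Asymptotics.isLittleO_norm_right] at hint
  refine (zero_add (c / ((β : ℂ) + 1)) ▸ hint.tendsto_div_nhds_zero.add_const _).congr' ?_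
  filter_upwards [Filter.eventually_gt_atTop 0] with x hx
  have hx0 : ((x ^ (β + 1) : ℝ) : ℂ) ≠ 0 :=
    Complex.ofReal_ne_zero.2 (Real.rpow_pos_of_pos hx _).ne'
  rw [intervalIntegral.integral_sub (hgi 0 x) (hpow 0 x), intervalIntegral.integral_const_mul,
    intervalIntegral.integral_ofReal, integral_rpow (.inl hβ),
    Real.zero_rpow (by linarith : 0 < β + 1).ne', sub_zero]
  push_cast
  field_simp
  ring
end

section
/- Let f ∈ C₊(ℝ), let α ∈ ℝ with α ∉ {−1, −2, −3, …}, and let γ ∈ ℂ. If f(x)/x^α → γ as x → ∞, then there exists a constant c ∈ ℂ such that (Γ(α+2)·∫₀ˣ f(t) dt − c)/x^{α+1} → Γ(α+1)·γ as x → ∞. -/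
open Filter Asymptotics MeasureTheory Set Topology

/-- Integration from `0` preserves `o(x^a)` estimates at infinity when `-1 < a`. -/
theorem isLittleO_intervalIntegral_rpow {g : ℝ → ℂ} {a : ℝ} (ha : -1 < a)
    (hg : ∀ u v : ℝ, IntervalIntegrable g volume u v)
    (h : g =o[atTop] fun t : ℝ => t ^ a) :
    (fun x : ℝ => ∫ t in (0 : ℝ)..x, g t) =o[atTop] fun x : ℝ => x ^ (a + 1) := by
  have ha' : 0 < a + 1 := by linarith
  refine IsLittleO.of_bound fun ε hε => ?_
  have hδ : 0 < ε / 2 * (a + 1) := by positivity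
  obtain ⟨N, hN⟩ := eventually_atTop.1 ((h.def hδ).and (eventually_ge_atTop (1 : ℝ)))
  have hN1 : 1 ≤ N := (hN N le_rfl).2
  have hlarge := (tendsto_rpow_atTop ha').eventually_ge_atTop (‖∫ t in (0 : ℝ)..N, g t‖ / (ε / 2))
  filter_upwards [hlarge, eventually_ge_atTop N] with x hx hNx
  have hx0 : 0 < x := by linarith
  rw [div_le_iff₀ (by positivity)] at hx
  have hint : IntervalIntegrable (fun t : ℝ => ε / 2 * (a + 1) * t ^ a) volume N x :=
    (intervalIntegral.intervalIntegrable_rpow' ha).const_mul _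
  have htail : ‖∫ t in N..x, g t‖ ≤ ε / 2 * x ^ (a + 1) := by
    calc ‖∫ t in N..x, g t‖ ≤ ∫ t in N..x, ε / 2 * (a + 1) * t ^ a := by
          refine intervalIntegral.norm_integral_le_of_norm_le hNx (ae_of_all _ fun t ht => ?_) hint
          have ht0 : 0 ≤ t := by linarith [ht.1]
          simpa [abs_of_nonneg (Real.rpow_nonneg ht0 a)] using (hN t ht.1.le).1
      _ = ε / 2 * (x ^ (a + 1) - N ^ (a + 1)) := by
          rw [intervalIntegral.integral_const_mul, integral_rpow (Or.inl ha)]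
          field_simp
      _ ≤ ε / 2 * x ^ (a + 1) := by
          have : 0 ≤ N ^ (a + 1) := Real.rpow_nonneg (by linarith) _
          gcongr
          linarith
  rw [← intervalIntegral.integral_add_adjacent_intervals (hg 0 N) (hg N x), Real.norm_eq_abs,
    abs_of_nonneg (Real.rpow_nonneg hx0.le _)]
  linarith [norm_add_le (∫ t in (0 : ℝ)..N, g t) (∫ t in N..x, g t)]

/-- Integration up to infinity preserves `o(x^a)` estimates when `a < -1`. -/
theorem isLittleO_integral_Ioi_rpow {g : ℝ → ℂ} {a : ℝ} (ha : a < -1)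
    (h : g =o[atTop] fun t : ℝ => t ^ a) :
    (fun x : ℝ => ∫ t in Ioi x, g t) =o[atTop] fun x : ℝ => x ^ (a + 1) := by
  have ha' : 0 < -(a + 1) := by linarith
  have hne : a + 1 ≠ 0 := by linarith
  refine IsLittleO.of_bound fun ε hε => ?_
  have hδ : 0 < ε * -(a + 1) := by positivity
  obtain ⟨N, hN⟩ := eventually_atTop.1 ((h.def hδ).and (eventually_ge_atTop (1 : ℝ)))
  have hN1 : 1 ≤ N := (hN N le_rfl).2
  filter_upwards [eventually_ge_atTop N] with x hNx
  have hx0 : 0 < x := by linarith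
  calc ‖∫ t in Ioi x, g t‖ ≤ ∫ t in Ioi x, ε * -(a + 1) * t ^ a := by
        refine norm_integral_le_of_norm_le ((integrableOn_Ioi_rpow_of_lt ha hx0).const_mul _) ?_
        refine (ae_restrict_iff' measurableSet_Ioi).2 (ae_of_all _ fun t ht => ?_)
        have ht' : x < t := ht
        have ht0 : 0 ≤ t := by linarith
        simpa only [Real.norm_eq_abs, abs_of_nonneg (Real.rpow_nonneg ht0 a)] using
          (hN t (by linarith)).1
    _ = ε * ‖x ^ (a + 1)‖ := by
        rw [integral_const_mul, integral_Ioi_rpow_of_lt ha hx0, Real.norm_eq_abs,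
          abs_of_nonneg (Real.rpow_nonneg hx0.le _)]
        field_simp

/-- If `f(x)/x^a → γ` with `a ≠ -1`, then, up to an additive constant, `∫₀ˣ f` is asymptotically
`γ x^(a+1)/(a+1)`. -/
theorem exists_integral_sub_isLittleO_rpow {f : ℝ → ℂ} (hf : Continuous f) {a : ℝ} (ha : a ≠ -1)
    {γ : ℂ} (h : (fun x : ℝ => f x - γ * ((x ^ a : ℝ) : ℂ)) =o[atTop] fun x : ℝ => x ^ a) :
    ∃ c : ℂ, (fun x : ℝ => (∫ t in (0 : ℝ)..x, f t) - c -
      γ / ((a + 1 : ℝ) : ℂ) * ((x ^ (a + 1) : ℝ) : ℂ)) =o[atTop] fun x : ℝ => x ^ (a + 1) := by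
  rcases ha.lt_or_gt with ha | ha
  · have hpow : ∀ x : ℝ, 0 < x → IntegrableOn (fun t : ℝ => γ * ((t ^ a : ℝ) : ℂ)) (Ioi x) :=
      fun x hx => (integrableOn_Ioi_rpow_of_lt ha hx).ofReal.const_mul γ
    have hO : f =O[atTop] fun x : ℝ => x ^ a := by
      have hγ : (fun x : ℝ => γ * ((x ^ a : ℝ) : ℂ)) =O[atTop] fun x : ℝ => x ^ a :=
        IsBigO.of_bound ‖γ‖ (Eventually.of_forall fun x => by simp)
      simpa using h.isBigO.add hγ
    have hfi : ∀ x : ℝ, IntegrableOn f (Ioi x) := fun x =>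
      (hf.locallyIntegrable.locallyIntegrableOn (Ici x)).integrableOn_of_isBigO_atTop hO
        ⟨Ioi 1, Ioi_mem_atTop 1, integrableOn_Ioi_rpow_of_lt ha one_pos⟩
        |>.mono_set Ioi_subset_Ici_self
    refine ⟨∫ t in Ioi (0 : ℝ), f t, ?_⟩
    refine (isLittleO_integral_Ioi_rpow ha h).neg_left.congr' ?_ EventuallyEq.rfl
    filter_upwards [eventually_gt_atTop (0 : ℝ)] with x hx
    rw [integral_sub (hfi x) (hpow x hx), integral_const_mul, integral_complex_ofReal,
      integral_Ioi_rpow_of_lt ha hx,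
      ← intervalIntegral.integral_interval_add_Ioi (hfi 0) (hfi x)]
    push_cast
    ring
  · have hpow : ∀ u v : ℝ, IntervalIntegrable (fun t : ℝ => γ * ((t ^ a : ℝ) : ℂ)) volume u v :=
      fun u v => IntervalIntegrable.const_mul
        ⟨(intervalIntegral.intervalIntegrable_rpow' ha).1.ofReal,
          (intervalIntegral.intervalIntegrable_rpow' ha).2.ofReal⟩ γ
    refine ⟨0, ?_⟩
    refine (isLittleO_intervalIntegral_rpow ha
      (fun u v => (hf.intervalIntegrable u v).sub (hpow u v)) h).congr_left fun x => ?_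
    rw [intervalIntegral.integral_sub (hf.intervalIntegrable 0 x) (hpow 0 x),
      intervalIntegral.integral_const_mul, intervalIntegral.integral_ofReal,
      integral_rpow (Or.inl ha), Real.zero_rpow (by linarith)]
    push_cast
    ring


/-- If `f(x)/x^α → γ`, then `(Γ(α+2) ∫₀ˣ f - c)/x^(α+1) → Γ(α+1) γ` for some
constant `c`: i.e. `W_f(x) ∼ γ x^α (C)`. -/
theorem stmt7 (f : ℝ → ℂ) (hf : Continuous f) (hf0 : ∀ x : ℝ, x < 0 → f x = 0)
    (α : ℝ) (hα : ∀ n : ℕ, α ≠ -(n + 1 : ℝ)) (γ : ℂ)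
    (h : Filter.Tendsto (fun x : ℝ => f x / ((x ^ α : ℝ) : ℂ)) Filter.atTop (nhds γ)) :
    ∃ c : ℂ, Filter.Tendsto
      (fun x : ℝ =>
        ((Real.Gamma (α + 2) : ℂ) * (∫ t in (0:ℝ)..x, f t) - c) / ((x ^ (α + 1) : ℝ) : ℂ))
      Filter.atTop (nhds ((Real.Gamma (α + 1) : ℂ) * γ)) := by
  have ha1 : α ≠ -1 := by simpa using hα 0
  have hne : α + 1 ≠ 0 := fun h0 => ha1 (by linarith)
  have hpow : ∀ b : ℝ, ∀ᶠ x : ℝ in Filter.atTop, ((x ^ b : ℝ) : ℂ) ≠ 0 := fun b => by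
    filter_upwards [Filter.eventually_gt_atTop (0 : ℝ)] with x hx
    exact Complex.ofReal_ne_zero.2 (Real.rpow_pos_of_pos hx b).ne'
  have hlo : (fun x : ℝ => f x - γ * ((x ^ α : ℝ) : ℂ)) =o[Filter.atTop] fun x : ℝ => x ^ α := by
    rw [← Complex.isLittleO_ofReal_right,
      isLittleO_iff_tendsto' ((hpow α).mono fun x hx h0 => absurd h0 hx)]
    refine (sub_self γ ▸ h.sub_const γ).congr' ?_
    filter_upwards [hpow α] with x hx
    field_simp
  obtain ⟨c, hc⟩ := exists_integral_sub_isLittleO_rpow hf ha1 hlo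
  refine ⟨(Real.Gamma (α + 2) : ℂ) * c, ?_⟩
  have hG : Real.Gamma (α + 2) = (α + 1) * Real.Gamma (α + 1) := by
    rw [← Real.Gamma_add_one hne]
    ring_nf
  have hneC : ((α + 1 : ℝ) : ℂ) ≠ 0 := Complex.ofReal_ne_zero.2 hne
  have hlim := ((Complex.isLittleO_ofReal_right.2 hc).tendsto_div_nhds_zero.add_const
    (γ / ((α + 1 : ℝ) : ℂ))).const_mul (Real.Gamma (α + 2) : ℂ)
  rw [zero_add] at hlim
  have heq : (Real.Gamma (α + 2) : ℂ) * (γ / ((α + 1 : ℝ) : ℂ)) = (Real.Gamma (α + 1) : ℂ) * γ := by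
    rw [hG, Complex.ofReal_mul]
    field_simp
  rw [heq] at hlim
  refine hlim.congr' ?_
  filter_upwards [hpow (α + 1)] with x hx
  field_simp
  ring
end

section
/- Let f ∈ C₊(ℝ), let k ≥ 2 be an integer, let α ∈ ℝ with α ∉ {−1, −2, −3, …}, and let γ ∈ ℂ. Suppose there is a polynomial p with complex coefficients, deg p ≤ k−1, such that (Γ(α+k+1)·f(x) − p(x))/x^{α+k} → γ as x → ∞. Then there exists a polynomial q with complex coefficients, deg q ≤ k−1, such that (Γ(α+k+2)·(x·f(x) − k·∫₀ˣ f(t) dt) − q(x))/x^{α+k+1} → (α+1)·γ as x → ∞. -/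
open Filter MeasureTheory Set Topology Asymptotics

/-- Integrating a little-o bound by a power larger than `-1` from a fixed base point. -/
lemma isLittleO_integral_rpow_of_gt {h : ℝ → ℂ} {s : ℝ} (hs : -1 < s)
    (hc : ContinuousOn h (Ici 1)) (ho : h =o[atTop] fun x : ℝ => x ^ s) :
    (fun x : ℝ => ∫ t in (1 : ℝ)..x, h t) =o[atTop] fun x : ℝ => x ^ (s + 1) := by
  have hs1 : 0 < s + 1 := by linarith
  have hii : ∀ a b : ℝ, 1 ≤ a → 1 ≤ b → IntervalIntegrable h volume a b := fun a b ha hb =>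
    (hc.mono fun t ht => (le_min ha hb).trans ht.1).intervalIntegrable
  rw [isLittleO_iff]
  intro ε hε
  have hδ : 0 < ε * (s + 1) / 2 := by positivity
  obtain ⟨a, ha⟩ := eventually_atTop.1 ((isLittleO_iff.1 ho hδ).and (eventually_ge_atTop 1))
  have ha1 : 1 ≤ a := (ha a le_rfl).2
  have htop : ∀ᶠ x : ℝ in atTop, ‖∫ t in (1 : ℝ)..a, h t‖ * (2 / ε) ≤ x ^ (s + 1) :=
    (tendsto_rpow_atTop hs1).eventually_ge_atTop _
  filter_upwards [htop, eventually_ge_atTop a] with x hx hax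
  have hx0 : 0 < x := by linarith
  rw [Real.norm_of_nonneg (Real.rpow_nonneg hx0.le _),
    ← intervalIntegral.integral_add_adjacent_intervals (hii 1 a le_rfl ha1)
      (hii a x ha1 (ha1.trans hax))]
  have htail : ‖∫ t in a..x, h t‖ ≤ ∫ t in a..x, ε * (s + 1) / 2 * t ^ s := by
    refine intervalIntegral.norm_integral_le_of_norm_le hax
      (ae_of_all _ fun t ht => ?_) ((intervalIntegral.intervalIntegrable_rpow' hs).const_mul _)
    have h1 := (ha t ht.1.le).1
    rwa [Real.norm_of_nonneg (Real.rpow_nonneg (by linarith [ht.1]) _)] at h1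
  rw [intervalIntegral.integral_const_mul, integral_rpow (Or.inl hs)] at htail
  have hcalc : ε * (s + 1) / 2 * ((x ^ (s + 1) - a ^ (s + 1)) / (s + 1))
      = ε / 2 * (x ^ (s + 1) - a ^ (s + 1)) := by field_simp
  have hapow : 0 ≤ ε / 2 * a ^ (s + 1) := by positivity
  have hhead : ‖∫ t in (1 : ℝ)..a, h t‖ ≤ ε / 2 * x ^ (s + 1) := by
    calc _ = ε / 2 * (‖∫ t in (1 : ℝ)..a, h t‖ * (2 / ε)) := by field_simp
      _ ≤ _ := by gcongr
  rw [hcalc] at htail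
  linarith [norm_add_le (∫ t in (1 : ℝ)..a, h t) (∫ t in a..x, h t)]

/-- Integrating a little-o bound by a power smaller than `-1` over the tail. -/
lemma isLittleO_integral_Ioi_rpow_of_lt {h : ℝ → ℂ} {s : ℝ} (hs : s < -1)
    (ho : h =o[atTop] fun x : ℝ => x ^ s) :
    (fun x : ℝ => ∫ t in Ioi x, h t) =o[atTop] fun x : ℝ => x ^ (s + 1) := by
  have hs1 : s + 1 < 0 := by linarith
  rw [isLittleO_iff]
  intro ε hε
  have hδ : 0 < ε * -(s + 1) := mul_pos hε (by linarith)
  obtain ⟨a, ha⟩ := eventually_atTop.1 (isLittleO_iff.1 ho hδ)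
  filter_upwards [eventually_ge_atTop a, eventually_gt_atTop 0] with x hax hx0
  rw [Real.norm_of_nonneg (Real.rpow_nonneg hx0.le _)]
  have htail : ‖∫ t in Ioi x, h t‖ ≤ ∫ t in Ioi x, ε * -(s + 1) * t ^ s := by
    refine norm_integral_le_of_norm_le ((integrableOn_Ioi_rpow_of_lt hs hx0).const_mul _) ?_
    filter_upwards [ae_restrict_mem measurableSet_Ioi] with t ht
    have ht' : x < t := ht
    have h1 := ha t (by linarith)
    rwa [Real.norm_of_nonneg (Real.rpow_nonneg (by linarith) _)] at h1
  rw [integral_const_mul, integral_Ioi_rpow_of_lt hs hx0] at htail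
  refine htail.trans_eq ?_
  field_simp [hs1.ne]

/-- Up to an additive constant, integration raises the exponent of a little-o bound by one. -/
lemma exists_isLittleO_integral_sub_const {h : ℝ → ℂ} {s : ℝ} (hs : s ≠ -1)
    (hc : ContinuousOn h (Ici 1)) (ho : h =o[atTop] fun x : ℝ => x ^ s) :
    ∃ C : ℂ, (fun x : ℝ => (∫ t in (1 : ℝ)..x, h t) - C) =o[atTop]
      fun x : ℝ => x ^ (s + 1) := by
  rcases lt_or_gt_of_ne hs with hs' | hs'
  · have hint : IntegrableOn h (Ici 1) :=
      (hc.locallyIntegrableOn measurableSet_Ici).integrableOn_of_isBigO_atTop ho.isBigO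
        ⟨Ioi 1, Ioi_mem_atTop 1, integrableOn_Ioi_rpow_of_lt hs' one_pos⟩
    have hint' : IntegrableOn h (Ioi 1) := hint.mono_set Ioi_subset_Ici_self
    refine ⟨∫ t in Ioi 1, h t, (isLittleO_integral_Ioi_rpow_of_lt hs' ho).neg_left.congr'
      ?_ EventuallyEq.rfl⟩
    filter_upwards [eventually_ge_atTop 1] with x hx
    rw [← intervalIntegral.integral_Ioi_sub_Ioi hint' hx]
    ring
  · exact ⟨0, by simpa using isLittleO_integral_rpow_of_gt hs' hc ho⟩

/-- Asymptotics `g x ∼ γ x ^ s` with `s ≠ -1` can be integrated, up to an additive constant. -/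
lemma exists_tendsto_integral_sub_const_div_rpow {g : ℝ → ℂ} {s : ℝ} {γ : ℂ}
    (hg : Continuous g) (hs : s ≠ -1)
    (h : Tendsto (fun x : ℝ => g x / ((x ^ s : ℝ) : ℂ)) atTop (𝓝 γ)) :
    ∃ C : ℂ, Tendsto (fun x : ℝ => ((∫ t in (0 : ℝ)..x, g t) - C) / ((x ^ (s + 1) : ℝ) : ℂ))
      atTop (𝓝 (γ / (s + 1))) := by
  have hs1 : (s : ℂ) + 1 ≠ 0 := by
    intro h0
    exact hs (by exact_mod_cast eq_neg_of_add_eq_zero_left h0)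
  have hpow : ContinuousOn (fun t : ℝ => ((t ^ s : ℝ) : ℂ)) (Ici 1) :=
    Complex.continuous_ofReal.comp_continuousOn <|
      continuousOn_id.rpow_const fun t ht => Or.inl (zero_lt_one.trans_le ht).ne'
  have hne : ∀ r : ℝ, ∀ᶠ x : ℝ in atTop, ((x ^ r : ℝ) : ℂ) ≠ 0 := fun r => by
    filter_upwards [eventually_gt_atTop 0] with x hx
    exact_mod_cast (Real.rpow_pos_of_pos hx r).ne'
  have ho : (fun t : ℝ => g t - γ * ((t ^ s : ℝ) : ℂ)) =o[atTop] fun x : ℝ => x ^ s := by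
    refine IsLittleO.of_norm_right ?_
    suffices (fun t : ℝ => g t - γ * ((t ^ s : ℝ) : ℂ)) =o[atTop]
        fun x : ℝ => ((x ^ s : ℝ) : ℂ) by simpa using this.norm_right
    rw [isLittleO_iff_tendsto' ((hne s).mono fun x hx h0 => absurd h0 hx)]
    have h1 := h.sub_const γ
    rw [sub_self] at h1
    refine h1.congr' ?_
    filter_upwards [hne s] with x hx
    field_simp
  obtain ⟨C, hC⟩ := exists_isLittleO_integral_sub_const hs
    (hg.continuousOn.sub (continuousOn_const.mul hpow)) ho
  refine ⟨(∫ t in (0 : ℝ)..1, g t) - γ / (s + 1) + C, ?_⟩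
  have hC' : Tendsto (fun x : ℝ => ((∫ t in (1 : ℝ)..x, g t - γ * ((t ^ s : ℝ) : ℂ)) - C) /
      ((x ^ (s + 1) : ℝ) : ℂ)) atTop (𝓝 0) := by
    refine IsLittleO.tendsto_div_nhds_zero (IsLittleO.of_norm_right ?_)
    simpa using hC.norm_right
  have h2 := hC'.add_const (γ / (s + 1))
  rw [zero_add] at h2
  refine h2.congr' ?_
  filter_upwards [hne (s + 1), eventually_ge_atTop 1] with x hx hx1
  have hpi : IntervalIntegrable (fun t : ℝ => γ * ((t ^ s : ℝ) : ℂ)) volume 1 x :=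
    ((continuousOn_const.mul hpow).mono fun t ht =>
      (le_min le_rfl hx1).trans ht.1).intervalIntegrable
  have hrp : (∫ t in (1 : ℝ)..x, ((t ^ s : ℝ) : ℂ)) = (((x ^ (s + 1) : ℝ) : ℂ) - 1) / (s + 1) := by
    rw [intervalIntegral.integral_ofReal, integral_rpow (Or.inr ⟨hs, ?_⟩)]
    · push_cast
      simp
    · intro h0
      rw [uIcc_of_le hx1] at h0
      linarith [h0.1]
  rw [intervalIntegral.integral_sub (hg.intervalIntegrable _ _) hpi,
    intervalIntegral.integral_const_mul, hrp,
    ← intervalIntegral.integral_add_adjacent_intervals (hg.intervalIntegrable 0 1)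
      (hg.intervalIntegrable 1 x)]
  field_simp
  ring

/-- The operator `p ↦ x p - (m + 1) ∫₀ˣ p` preserves polynomials of degree at most `m`. -/
lemma exists_polynomial_mul_sub_integral (m : ℕ) (p : Polynomial ℂ) (hp : p.degree ≤ m) :
    ∃ r : Polynomial ℂ, r.degree ≤ m ∧ ∀ x : ℝ,
      (x : ℂ) * p.eval (x : ℂ) - ((m : ℂ) + 1) * ∫ t in (0 : ℝ)..x, p.eval (t : ℂ)
        = r.eval (x : ℂ) := by
  have hlt : p.natDegree < m + 1 := Nat.lt_succ_of_le (Polynomial.natDegree_le_of_degree_le hp)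
  refine ⟨∑ j ∈ Finset.range m, Polynomial.C (p.coeff j * (1 - ((m : ℂ) + 1) / (j + 1))) *
    Polynomial.X ^ (j + 1), ?_, fun x => ?_⟩
  · refine (Polynomial.degree_sum_le _ _).trans (Finset.sup_le fun j hj => ?_)
    refine (Polynomial.degree_C_mul_X_pow_le _ _).trans ?_
    exact_mod_cast Finset.mem_range.1 hj
  · have hpow : ∀ j : ℕ, (∫ t in (0 : ℝ)..x, (t : ℂ) ^ j) = (x : ℂ) ^ (j + 1) / (j + 1) := by
      intro j
      have h1 : (∫ t in (0 : ℝ)..x, (((t ^ j : ℝ)) : ℂ)) = (x : ℂ) ^ (j + 1) / (j + 1) := by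
        rw [intervalIntegral.integral_ofReal, integral_pow]
        push_cast
        simp
      simpa using h1
    have hint : (∫ t in (0 : ℝ)..x, p.eval (t : ℂ))
        = ∑ j ∈ Finset.range (m + 1), p.coeff j * ((x : ℂ) ^ (j + 1) / (j + 1)) := by
      simp_rw [Polynomial.eval_eq_sum_range' hlt]
      rw [intervalIntegral.integral_finsetSum fun j _ =>
        Continuous.intervalIntegrable (by fun_prop) _ _]
      simp_rw [intervalIntegral.integral_const_mul, hpow]
    have hm : (m : ℂ) + 1 ≠ 0 := Nat.cast_add_one_ne_zero m
    rw [hint, Polynomial.eval_eq_sum_range' hlt, Finset.mul_sum, Finset.mul_sum,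
      ← Finset.sum_sub_distrib, Finset.sum_range_succ, Polynomial.eval_finsetSum]
    have hlast : (x : ℂ) * (p.coeff m * (x : ℂ) ^ m)
        - ((m : ℂ) + 1) * (p.coeff m * ((x : ℂ) ^ (m + 1) / (m + 1))) = 0 := by
      field_simp
      ring
    rw [hlast, add_zero]
    refine Finset.sum_congr rfl fun j _ => ?_
    simp only [Polynomial.eval_mul, Polynomial.eval_C, Polynomial.eval_pow, Polynomial.eval_X]
    ring

/-- If `W = f/H^k` satisfies `W(x) ∼ γ x^α/Γ(α+1) (C)`, then
`xW = (xf - k H∗f)/H^k` satisfies `xW(x) ∼ γ x^(α+1)/Γ(α+1) (C)`: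
at the level of representatives, if `(Γ(α+k+1) f(x) - p(x))/x^(α+k) → γ` then
`(Γ(α+k+2)(x f(x) - k ∫₀ˣ f) - q(x))/x^(α+k+1) → (α+1) γ` for some polynomial `q`
of degree `≤ k-1`. -/
theorem stmt8 (f : ℝ → ℂ) (hf : Continuous f) (hf0 : ∀ x : ℝ, x < 0 → f x = 0)
    (k : ℕ) (hk : 2 ≤ k) (α : ℝ) (hα : ∀ n : ℕ, α ≠ -(n + 1 : ℝ)) (γ : ℂ)
    (h : ∃ p : Polynomial ℂ, p.degree ≤ (k - 1 : ℕ) ∧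
      Filter.Tendsto (fun x : ℝ =>
        ((Real.Gamma (α + k + 1) : ℂ) * f x - p.eval (x : ℂ)) / ((x ^ (α + k) : ℝ) : ℂ))
        Filter.atTop (nhds γ)) :
    ∃ q : Polynomial ℂ, q.degree ≤ (k - 1 : ℕ) ∧
      Filter.Tendsto (fun x : ℝ =>
        ((Real.Gamma (α + k + 2) : ℂ) *
            ((x : ℂ) * f x - (k : ℂ) * ∫ t in (0:ℝ)..x, f t) -
          q.eval (x : ℂ)) / ((x ^ (α + k + 1) : ℝ) : ℂ))
        Filter.atTop (nhds (((α : ℂ) + 1) * γ)) := by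
  obtain ⟨p, hp, h⟩ := h
  obtain ⟨m, rfl⟩ : ∃ m, k = m + 1 := ⟨k - 1, by omega⟩
  rw [Nat.add_sub_cancel] at hp ⊢
  obtain ⟨s, hs⟩ : ∃ s : ℝ, s = α + (m + 1 : ℕ) := ⟨_, rfl⟩
  have hs1 : s ≠ -1 := fun h0 => hα (m + 1) (by push_cast at hs ⊢; linarith)
  have hs1' : s + 1 ≠ 0 := fun h0 => hs1 (by linarith)
  have hs1C : (s : ℂ) + 1 ≠ 0 := by exact_mod_cast hs1'
  have hΓ : Real.Gamma (α + (m + 1 : ℕ) + 2) = (s + 1) * Real.Gamma (s + 1) := by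
    rw [← hs, ← Real.Gamma_add_one hs1']
    congr 1
    ring
  have hαC : (α : ℂ) = s - (m + 1) := by
    rw [hs]
    push_cast
    ring
  rw [hΓ, hαC]
  simp only [← hs] at h ⊢
  obtain ⟨c, hc⟩ : ∃ c : ℂ, c = (Real.Gamma (s + 1) : ℂ) := ⟨_, rfl⟩
  rw [← hc] at h
  have hpc : Continuous fun x : ℝ => p.eval (x : ℂ) := p.continuous.comp Complex.continuous_ofReal
  obtain ⟨C, hC⟩ := exists_tendsto_integral_sub_const_div_rpow
    (g := fun x => c * f x - p.eval (x : ℂ)) ((continuous_const.mul hf).sub hpc) hs1 h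
  obtain ⟨r, hr, hrx⟩ := exists_polynomial_mul_sub_integral m p hp
  refine ⟨Polynomial.C ((s : ℂ) + 1) * (r - Polynomial.C (((m : ℂ) + 1) * C)), ?_, ?_⟩
  · refine (Polynomial.degree_C_mul hs1C).trans_le ((Polynomial.degree_sub_le _ _).trans ?_)
    exact max_le hr (Polynomial.degree_C_le.trans (by exact_mod_cast Nat.zero_le m))
  · have hlim := (h.sub (hC.const_mul ((m : ℂ) + 1))).const_mul ((s : ℂ) + 1)
    have hval : ((s : ℂ) + 1) * (γ - ((m : ℂ) + 1) * (γ / (s + 1))) = (s - (m + 1) + 1) * γ := by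
      field_simp
      ring
    rw [hval] at hlim
    refine hlim.congr' ?_
    filter_upwards [eventually_gt_atTop 0] with x hx
    have hxs : ((x ^ s : ℝ) : ℂ) ≠ 0 := by exact_mod_cast (Real.rpow_pos_of_pos hx s).ne'
    have hxC : (x : ℂ) ≠ 0 := by exact_mod_cast hx.ne'
    have hcf : Continuous fun x => c * f x := continuous_const.mul hf
    rw [intervalIntegral.integral_sub (hcf.intervalIntegrable _ _)
      (hpc.intervalIntegrable _ _), intervalIntegral.integral_const_mul, Real.rpow_add_one hx.ne']
    simp only [Polynomial.eval_mul, Polynomial.eval_C, Polynomial.eval_sub, ← hrx x]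
    push_cast
    rw [← hc]
    field_simp
    ring
end

section
/- Let f ∈ C₊(ℝ), let k ≥ 1 be an integer, let α > −1 be real, and let γ ∈ ℂ. Suppose Γ(α+k+1)·f(x)/x^{α+k} → γ as x → ∞. Then there exists σ > 0 such that e^{−σx}f(x) is bounded for x ≥ 0, the Laplace integral ∫₀^∞ e^{−zx} f(x) dx converges for every z ∈ ℂ with Re z > 0, and for every θ ∈ [0, π/2), z^{α+k+1}·∫₀^∞ e^{−zx} f(x) dx → γ as z → 0 with z ∈ S_θ (i.e., as |z| → 0 with |arg z| ≤ θ). -/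
open Set Filter in
/-- A continuous function that is `o(x ^ b)` at infinity is at most `ε x ^ b + C` on `[0, ∞)`. -/
theorem exists_norm_le_rpow_add_of_isLittleO {g : ℝ → ℂ} (hg : Continuous g) {b : ℝ}
    (ho : g =o[atTop] fun x : ℝ => x ^ b) {ε : ℝ} (hε : 0 < ε) :
    ∃ C : ℝ, 0 ≤ C ∧ ∀ x : ℝ, 0 ≤ x → ‖g x‖ ≤ ε * x ^ b + C := by
  obtain ⟨A, hA⟩ := eventually_atTop.1 (ho.bound hε)
  obtain ⟨C, hC⟩ := (isCompact_Icc (a := (0 : ℝ)) (b := A)).exists_bound_of_continuousOn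
    hg.continuousOn
  refine ⟨max C 0, le_max_right _ _, fun x hx => ?_⟩
  have hxb : 0 ≤ x ^ b := Real.rpow_nonneg hx b
  rcases le_total x A with hxA | hxA
  · have := hC x ⟨hx, hxA⟩
    have := le_max_left C 0
    nlinarith [mul_nonneg hε.le hxb]
  · have := hA x hxA
    rw [Real.norm_of_nonneg hxb] at this
    linarith [le_max_right C 0]

theorem Real.rpow_le_rpow_self_mul_exp {b x : ℝ} (hb : 0 < b) (hx : 0 ≤ x) :
    x ^ b ≤ b ^ b * Real.exp x := by
  have h1 : x / b ≤ Real.exp (x / b) := by linarith [Real.add_one_le_exp (x / b)]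
  have h2 := Real.rpow_le_rpow (div_nonneg hx hb.le) h1 hb.le
  rw [← Real.exp_mul, div_mul_cancel₀ _ hb.ne', Real.div_rpow hx hb.le,
    div_le_iff₀ (Real.rpow_pos_of_pos hb b)] at h2
  linarith

open MeasureTheory Set in
/-- The integral of `e ^ (-s x) (K x ^ b + C)` over `(0, ∞)`, together with integrability. -/
theorem integrableOn_and_integral_exp_neg_mul_mul_rpow_add {b s : ℝ} (hb : 0 < b) (hs : 0 < s)
    (K C : ℝ) :
    IntegrableOn (fun x : ℝ => Real.exp (-s * x) * (K * x ^ b + C)) (Ioi 0) ∧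
    ∫ x in Ioi (0 : ℝ), Real.exp (-s * x) * (K * x ^ b + C) =
      K * (Real.Gamma (b + 1) / s ^ (b + 1)) + C / s := by
  have h1 : IntegrableOn (fun x : ℝ => x ^ b * Real.exp (-s * x)) (Ioi 0) := by
    simpa using integrableOn_rpow_mul_exp_neg_mul_rpow (p := 1) (by linarith) one_pos hs
  have h2 : IntegrableOn (fun x : ℝ => Real.exp (-s * x)) (Ioi 0) :=
    integrableOn_exp_mul_Ioi (by linarith) 0
  have e : (fun x : ℝ => Real.exp (-s * x) * (K * x ^ b + C)) =
      fun x => K * (x ^ b * Real.exp (-s * x)) + C * Real.exp (-s * x) := by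
    funext x; ring
  rw [e]
  refine ⟨(h1.const_mul K).add (h2.const_mul C), ?_⟩
  have h3 := Real.integral_rpow_mul_exp_neg_mul_Ioi (a := b + 1) (by linarith) hs
  rw [integral_add (h1.const_mul K) (h2.const_mul C), integral_const_mul, integral_const_mul,
    integral_exp_mul_Ioi (by linarith)]
  simp only [add_sub_cancel_right, ← neg_mul] at h3
  rw [h3, Real.div_rpow zero_le_one hs.le]
  simp
  field_simp

theorem norm_exp_neg_mul_mul_le {z w : ℂ} {x s B : ℝ} (hx : 0 ≤ x) (hs : s ≤ z.re)
    (hw : ‖w‖ ≤ B) : ‖Complex.exp (-z * x) * w‖ ≤ Real.exp (-s * x) * B := by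
  rw [norm_mul, Complex.norm_exp]
  have : (-z * (x : ℂ)).re ≤ -s * x := by
    simp
    nlinarith
  gcongr

open MeasureTheory Set in
theorem integrableOn_exp_neg_mul_of_norm_le_rpow_add {g : ℝ → ℂ} (hg : Continuous g)
    {b K C : ℝ} (hb : 0 < b) (hgb : ∀ x : ℝ, 0 ≤ x → ‖g x‖ ≤ K * x ^ b + C)
    {z : ℂ} (hz : 0 < z.re) :
    IntegrableOn (fun x : ℝ => Complex.exp (-z * x) * g x) (Ioi 0) := by
  refine (integrableOn_and_integral_exp_neg_mul_mul_rpow_add hb hz K C).1.mono'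
    (by fun_prop) ?_
  filter_upwards [ae_restrict_mem measurableSet_Ioi] with x hx
  exact norm_exp_neg_mul_mul_le (le_of_lt hx) le_rfl (hgb x (le_of_lt hx))

open MeasureTheory Set in
theorem norm_integral_exp_neg_mul_le {g : ℝ → ℂ} {b K C s : ℝ} (hb : 0 < b)
    (hgb : ∀ x : ℝ, 0 ≤ x → ‖g x‖ ≤ K * x ^ b + C) {z : ℂ} (hs : 0 < s) (hz : s ≤ z.re) :
    ‖∫ x in Ioi (0 : ℝ), Complex.exp (-z * x) * g x‖ ≤
      K * (Real.Gamma (b + 1) / s ^ (b + 1)) + C / s := by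
  obtain ⟨hi, he⟩ := integrableOn_and_integral_exp_neg_mul_mul_rpow_add hb hs K C
  rw [← he]
  refine norm_integral_le_of_norm_le hi ?_
  filter_upwards [ae_restrict_mem measurableSet_Ioi] with x hx
  exact norm_exp_neg_mul_mul_le (le_of_lt hx) hz (hgb x (le_of_lt hx))

theorem Complex.norm_mul_cos_le_re {z : ℂ} {θ : ℝ} (hθ : θ ≤ Real.pi) (hz : |z.arg| ≤ θ) :
    ‖z‖ * Real.cos θ ≤ z.re := by
  rw [← Complex.norm_mul_cos_arg z, ← Real.cos_abs z.arg]
  exact mul_le_mul_of_nonneg_left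
    (Real.cos_le_cos_of_nonneg_of_le_pi (abs_nonneg _) hθ hz) (norm_nonneg z)

open MeasureTheory Set in
theorem differentiableOn_integral_exp_neg_mul_rpow {b : ℝ} (hb : 0 < b) :
    DifferentiableOn ℂ
      (fun z : ℂ => ∫ x in Ioi (0 : ℝ), Complex.exp (-z * x) * ((x ^ b : ℝ) : ℂ))
      {z : ℂ | 0 < z.re} := by
  intro z₀ hz₀
  have hp : Continuous fun x : ℝ => ((x ^ b : ℝ) : ℂ) :=
    Complex.continuous_ofReal.comp (Real.continuous_rpow_const hb.le)
  have hs : 0 < z₀.re / 2 := half_pos hz₀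
  have hU : {z : ℂ | z₀.re / 2 < z.re} ∈ nhds z₀ :=
    (isOpen_lt continuous_const Complex.continuous_re).mem_nhds
      (show z₀.re / 2 < z₀.re from half_lt_self hz₀)
  have hint : Integrable (fun x : ℝ => x ^ (b + 1) * Real.exp (-(z₀.re / 2) * x))
      (volume.restrict (Ioi 0)) := by
    simpa [IntegrableOn] using
      integrableOn_rpow_mul_exp_neg_mul_rpow (p := 1) (s := b + 1) (by linarith) one_pos hs
  refine (hasDerivAt_integral_of_dominated_loc_of_deriv_le (𝕜 := ℂ)
    (F' := fun z x => Complex.exp (-z * x) * (-(x : ℂ) * ((x ^ b : ℝ) : ℂ)))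
    (bound := fun x => x ^ (b + 1) * Real.exp (-(z₀.re / 2) * x))
    hU ?_ ?_ ?_ ?_ hint ?_).2.differentiableAt.differentiableWithinAt
  · exact Filter.Eventually.of_forall fun z => by fun_prop
  · exact integrableOn_exp_neg_mul_of_norm_le_rpow_add hp hb (K := 1) (C := 0)
      (fun x hx => by
        simp [abs_of_nonneg (Real.rpow_nonneg hx b)]) hz₀
  · fun_prop
  · filter_upwards [ae_restrict_mem measurableSet_Ioi] with x (hx : 0 < x) z hz
    rw [mul_comm (x ^ (b + 1))]
    refine norm_exp_neg_mul_mul_le hx.le (le_of_lt hz) ?_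
    rw [norm_mul, norm_neg, Complex.norm_real, Complex.norm_real,
      Real.norm_of_nonneg hx.le, Real.norm_of_nonneg (Real.rpow_nonneg hx.le b),
      Real.rpow_add_one hx.ne', mul_comm]
  · refine Filter.Eventually.of_forall fun x z _ => ?_
    have h1 : HasDerivAt (fun z : ℂ => -z * (x : ℂ)) (-(x : ℂ)) z := by
      simpa using (hasDerivAt_id z).neg.mul_const (x : ℂ)
    have h2 := h1.cexp.mul_const ((x ^ b : ℝ) : ℂ)
    rwa [mul_assoc] at h2

open MeasureTheory Set Filter Topology in
theorem cpow_mul_integral_exp_neg_mul_rpow {b : ℝ} (hb : 0 < b) {z : ℂ} (hz : 0 < z.re) :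
    z ^ ((b + 1 : ℝ) : ℂ) * ∫ x in Ioi (0 : ℝ), Complex.exp (-z * x) * ((x ^ b : ℝ) : ℂ) =
      Real.Gamma (b + 1) := by
  have hopen : IsOpen {z : ℂ | 0 < z.re} := isOpen_lt continuous_const Complex.continuous_re
  have hdiff : DifferentiableOn ℂ (fun z : ℂ => z ^ ((b + 1 : ℝ) : ℂ) *
      ∫ x in Ioi (0 : ℝ), Complex.exp (-z * x) * ((x ^ b : ℝ) : ℂ)) {z : ℂ | 0 < z.re} :=
    (differentiableOn_id.cpow_const fun z hz => Or.inl hz).mul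
      (differentiableOn_integral_exp_neg_mul_rpow hb)
  have hreal : ∀ r : ℝ, 0 < r → (r : ℂ) ^ ((b + 1 : ℝ) : ℂ) *
      ∫ x in Ioi (0 : ℝ), Complex.exp (-(r : ℂ) * x) * ((x ^ b : ℝ) : ℂ) =
        Real.Gamma (b + 1) := by
    intro r hr
    have h := (integrableOn_and_integral_exp_neg_mul_mul_rpow_add hb hr 1 0).2
    simp only [one_mul, add_zero, zero_div] at h
    have e : ∀ x : ℝ, Complex.exp (-(r : ℂ) * x) * ((x ^ b : ℝ) : ℂ) =
        ((Real.exp (-r * x) * x ^ b : ℝ) : ℂ) := fun x => by push_cast; rfl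
    simp_rw [e]
    rw [integral_complex_ofReal, h, ← Complex.ofReal_cpow hr.le, ← Complex.ofReal_mul,
      mul_div_cancel₀ _ (Real.rpow_pos_of_pos hr _).ne']
  have hfreq : ∃ᶠ w in 𝓝[≠] (1 : ℂ), w ^ ((b + 1 : ℝ) : ℂ) *
      ∫ x in Ioi (0 : ℝ), Complex.exp (-w * x) * ((x ^ b : ℝ) : ℂ) =
        Real.Gamma (b + 1) := by
    have ht : Tendsto (fun r : ℝ => (r : ℂ)) (𝓝[>] 1) (𝓝[≠] (1 : ℂ)) := by
      refine tendsto_nhdsWithin_iff.2 ⟨?_, ?_⟩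
      · exact (Complex.continuous_ofReal.tendsto' 1 1 Complex.ofReal_one).mono_left
          nhdsWithin_le_nhds
      · filter_upwards [self_mem_nhdsWithin] with r (hr : 1 < r)
        rw [mem_compl_singleton_iff]
        exact_mod_cast hr.ne'
    refine ht.frequently (Eventually.frequently ?_)
    filter_upwards [self_mem_nhdsWithin] with r (hr : 1 < r)
    exact hreal r (by linarith)
  exact (hdiff.analyticOnNhd hopen).eqOn_of_preconnected_of_frequently_eq
    analyticOnNhd_const (convex_halfSpace_re_gt 0).isPreconnected
    (show (1 : ℂ) ∈ {z : ℂ | 0 < z.re} by simp) hfreq hz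

open MeasureTheory Set Filter Topology in
/-- A continuous function that is `o(x ^ b)` at infinity has a Laplace transform that is
`o(z ^ (-b - 1))` at zero in sectors. -/
theorem tendsto_cpow_mul_laplace_zero_of_isLittleO {g : ℝ → ℂ} (hg : Continuous g) {b : ℝ}
    (hb : 0 < b) (ho : g =o[atTop] fun x : ℝ => x ^ b) {θ : ℝ} (hθ0 : 0 ≤ θ)
    (hθ : θ < Real.pi / 2) :
    Tendsto (fun z : ℂ => z ^ ((b + 1 : ℝ) : ℂ) *
        ∫ x in Ioi (0 : ℝ), Complex.exp (-z * x) * g x)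
      (𝓝[{z : ℂ | z ≠ 0 ∧ |z.arg| ≤ θ}] 0) (𝓝 0) := by
  have hc : 0 < Real.cos θ := Real.cos_pos_of_mem_Ioo ⟨by linarith [Real.pi_pos], hθ⟩
  have hb1 : 0 < b + 1 := by linarith
  have hG : 0 < Real.Gamma (b + 1) := Real.Gamma_pos_of_pos hb1
  set c := Real.cos θ
  have hcb : 0 < c ^ (b + 1) := Real.rpow_pos_of_pos hc _
  rw [Metric.tendsto_nhds]
  intro δ hδ
  obtain ⟨C, hC, hgC⟩ := exists_norm_le_rpow_add_of_isLittleO hg ho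
    (ε := δ / 2 * c ^ (b + 1) / Real.Gamma (b + 1)) (by positivity)
  have hlim : Tendsto (fun z : ℂ => C / c * ‖z‖ ^ b)
      (𝓝[{z : ℂ | z ≠ 0 ∧ |z.arg| ≤ θ}] 0) (𝓝 0) := by
    have : Continuous fun z : ℂ => C / c * ‖z‖ ^ b :=
      continuous_const.mul (continuous_norm.rpow_const fun _ => Or.inr hb.le)
    have h0 := this.tendsto 0
    simp only [norm_zero, Real.zero_rpow hb.ne', mul_zero] at h0
    exact h0.mono_left nhdsWithin_le_nhds
  filter_upwards [hlim.eventually_lt_const (half_pos hδ), self_mem_nhdsWithin] with z hz hzS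
  have hn : 0 < ‖z‖ := norm_pos_iff.2 hzS.1
  have hre : ‖z‖ * c ≤ z.re :=
    Complex.norm_mul_cos_le_re (by linarith [Real.pi_pos]) hzS.2
  have hI := norm_integral_exp_neg_mul_le hb hgC (mul_pos hn hc) hre
  have hnb : 0 < ‖z‖ ^ b := Real.rpow_pos_of_pos hn b
  rw [dist_zero_right, norm_mul, Complex.norm_cpow_of_ne_zero hzS.1]
  simp only [Complex.ofReal_re, Complex.ofReal_im, mul_zero, Real.exp_zero, div_one]
  refine (mul_le_mul_of_nonneg_left hI (by positivity)).trans_lt ?_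
  rw [Real.mul_rpow hn.le hc.le]
  have : ‖z‖ ^ (b + 1) * (δ / 2 * c ^ (b + 1) / Real.Gamma (b + 1) *
      (Real.Gamma (b + 1) / (‖z‖ ^ (b + 1) * c ^ (b + 1))) + C / (‖z‖ * c)) =
      δ / 2 + C / c * ‖z‖ ^ b := by
    have h1 : ‖z‖ ^ (b + 1) = ‖z‖ ^ b * ‖z‖ := by rw [Real.rpow_add hn, Real.rpow_one]
    rw [h1]
    field_simp
  rw [this]
  linarith


/-- Abelian theorem for the Laplace transform of `W = f/H^k`: if
`Γ(α+k+1) f(x)/x^(α+k) → γ` with `α > -1` (so `W(x) ∼ γ x^α/Γ(α+1) (C)`), then `f` is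
of exponential growth, the Laplace integral converges on `Re z > 0`, and
`z^(α+1) 𝓛W(z) = z^(α+k+1) ∫₀^∞ e^(-zx) f(x) dx → γ` as `z → 0` in sectors
`|arg z| ≤ θ < π/2`. -/
theorem stmt17 (f : ℝ → ℂ) (hf : Continuous f) (hf0 : ∀ x : ℝ, x < 0 → f x = 0)
    (k : ℕ) (hk : 1 ≤ k) (α : ℝ) (hα : -1 < α) (γ : ℂ)
    (h : Filter.Tendsto
      (fun x : ℝ => (Real.Gamma (α + k + 1) : ℂ) * f x / ((x ^ (α + k) : ℝ) : ℂ))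
      Filter.atTop (nhds γ)) :
    (∃ σ : ℝ, 0 < σ ∧ ∃ M : ℝ, ∀ x : ℝ, 0 ≤ x → Real.exp (-σ * x) * ‖f x‖ ≤ M) ∧
    (∀ z : ℂ, 0 < z.re →
      MeasureTheory.IntegrableOn (fun x : ℝ => Complex.exp (-z * x) * f x) (Set.Ioi 0)) ∧
    ∀ θ : ℝ, 0 ≤ θ → θ < Real.pi / 2 →
      Filter.Tendsto
        (fun z : ℂ => z ^ ((α + k + 1 : ℝ) : ℂ) *
          ∫ x in Set.Ioi (0:ℝ), Complex.exp (-z * x) * f x)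
        (nhdsWithin 0 {z : ℂ | z ≠ 0 ∧ |Complex.arg z| ≤ θ})
        (nhds γ) := by
  have hk' : (1 : ℝ) ≤ k := by exact_mod_cast hk
  have hb : 0 < α + k := by linarith
  set b : ℝ := α + k
  have hG : 0 < Real.Gamma (b + 1) := Real.Gamma_pos_of_pos (by linarith)
  have hG' : (Real.Gamma (b + 1) : ℂ) ≠ 0 := by exact_mod_cast hG.ne'
  set c : ℂ := γ / Real.Gamma (b + 1)
  let p : ℝ → ℂ := fun x => ((x ^ b : ℝ) : ℂ)
  have hp : Continuous p :=
    Complex.continuous_ofReal.comp (Real.continuous_rpow_const hb.le)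
  have hpn : ∀ x : ℝ, 0 ≤ x → ‖p x‖ = x ^ b := fun x hx => by
    simp only [p, Complex.norm_real, Real.norm_of_nonneg (Real.rpow_nonneg hx b)]
  let g : ℝ → ℂ := fun x => f x - c * p x
  have hg : Continuous g := hf.sub (continuous_const.mul hp)
  have ho : g =o[Filter.atTop] fun x : ℝ => x ^ b := by
    have hop : g =o[Filter.atTop] p := by
      rw [Asymptotics.isLittleO_iff_tendsto']
      · have h0 := (h.div_const (Real.Gamma (b + 1) : ℂ)).sub_const c
        rw [sub_self] at h0
        refine h0.congr' ?_
        filter_upwards [Filter.eventually_gt_atTop 0] with x hx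
        have hpx : p x ≠ 0 := by
          rw [← norm_pos_iff, hpn x hx.le]; exact Real.rpow_pos_of_pos hx b
        simp only [g]
        change (Real.Gamma (b + 1) : ℂ) * f x / p x / _ - c = _
        field_simp
      · filter_upwards [Filter.eventually_gt_atTop 0] with x hx hpx
        have := Real.rpow_pos_of_pos hx b
        rw [← hpn x hx.le, hpx, norm_zero] at this
        exact absurd this (lt_irrefl 0)
    refine hop.trans_isBigO (Asymptotics.IsBigO.of_bound 1 ?_)
    exact Filter.Eventually.of_forall fun x => by simp [p]
  obtain ⟨C, hC, hgC⟩ := exists_norm_le_rpow_add_of_isLittleO hg ho one_pos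
  have hfC : ∀ x : ℝ, 0 ≤ x → ‖f x‖ ≤ (1 + ‖c‖) * x ^ b + C := fun x hx => by
    have h1 : f x = g x + c * p x := by simp [g]
    have h2 := norm_add_le (g x) (c * p x)
    rw [← h1, norm_mul, hpn x hx] at h2
    linarith [hgC x hx]
  refine ⟨⟨1, one_pos, (1 + ‖c‖) * b ^ b + C, fun x hx => ?_⟩,
    fun z hz => integrableOn_exp_neg_mul_of_norm_le_rpow_add hf hb hfC hz,
    fun θ hθ0 hθ => ?_⟩
  · have hx1 : 1 ≤ Real.exp x := Real.one_le_exp hx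
    rw [neg_one_mul, Real.exp_neg, inv_mul_le_iff₀ (Real.exp_pos x)]
    have h1 := mul_le_mul_of_nonneg_left (Real.rpow_le_rpow_self_mul_exp hb hx)
      (show 0 ≤ 1 + ‖c‖ by positivity)
    nlinarith [hfC x hx]
  · have h0 := (tendsto_cpow_mul_laplace_zero_of_isLittleO hg hb ho hθ0 hθ).add_const γ
    rw [zero_add] at h0
    refine h0.congr' ?_
    filter_upwards [self_mem_nhdsWithin] with z hzS
    have hcos : 0 < Real.cos θ := Real.cos_pos_of_mem_Ioo ⟨by linarith [Real.pi_pos], hθ⟩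
    have hz : 0 < z.re := (mul_pos (norm_pos_iff.2 hzS.1) hcos).trans_le
      (Complex.norm_mul_cos_le_re (by linarith [Real.pi_pos]) hzS.2)
    have hig := integrableOn_exp_neg_mul_of_norm_le_rpow_add hg hb hgC hz
    have hip := integrableOn_exp_neg_mul_of_norm_le_rpow_add hp hb (K := 1) (C := 0)
      (fun x hx => by rw [hpn x hx]; simp) hz
    have e : (fun x : ℝ => Complex.exp (-z * x) * f x) =
        fun x : ℝ => Complex.exp (-z * x) * g x + c * (Complex.exp (-z * x) * p x) := by
      funext x; simp only [g]; ring
    rw [e, MeasureTheory.integral_add hig (hip.const_mul c),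
      MeasureTheory.integral_const_mul, mul_add, mul_left_comm _ c,
      cpow_mul_integral_exp_neg_mul_rpow hb hz, div_mul_cancel₀ _ hG']
end

section
/- Let f : ℝ → ℝ be continuous with f(x) = 0 for all x < 0 and f(x) ≥ 0 for all x, let k ≥ 1 be an integer, let α > −1 be real, and let γ ∈ ℝ with γ ≥ 0. Suppose that for every s > 0 the function x ↦ e^{−sx}f(x) is integrable on (0, ∞), and that s^{α+k+1}·∫₀^∞ e^{−sx} f(x) dx → γ as s → 0⁺. Then Γ(α+k+2)·(∫₀ˣ f(t) dt)/x^{α+k+1} → γ as x → ∞. -/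
open MeasureTheory Set Filter Topology

/-- The Laplace-type integral `∫₀^∞ e^(-sx) f(x) g(e^(-sx)) dx`. -/
noncomputable def weightedLaplace (f g : ℝ → ℝ) (s : ℝ) : ℝ :=
  ∫ x in Ioi (0 : ℝ), Real.exp (-s * x) * f x * g (Real.exp (-s * x))

lemma exp_neg_mul_mem_Icc {s x : ℝ} (hs : 0 < s) (hx : x ∈ Ioi (0 : ℝ)) :
    Real.exp (-s * x) ∈ Icc (0 : ℝ) 1 := by
  refine ⟨(Real.exp_pos _).le, Real.exp_le_one_iff.2 ?_⟩
  have := mul_pos hs (mem_Ioi.1 hx)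
  linarith

lemma integrableOn_weightedLaplace {f g : ℝ → ℝ} {s : ℝ} (hs : 0 < s) (hg : Continuous g)
    (hf : IntegrableOn (fun x => Real.exp (-s * x) * f x) (Ioi 0)) :
    IntegrableOn (fun x => Real.exp (-s * x) * f x * g (Real.exp (-s * x))) (Ioi 0) := by
  obtain ⟨c, hc⟩ := isCompact_Icc.exists_bound_of_continuousOn (s := Icc (0 : ℝ) 1) hg.continuousOn
  refine Integrable.mul_bdd (c := c) hf ?_ ?_
  · exact (by fun_prop : Continuous fun x => g (Real.exp (-s * x))).aestronglyMeasurable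
  · filter_upwards [ae_restrict_mem measurableSet_Ioi] with x hx
    exact hc _ (exp_neg_mul_mem_Icc hs hx)

lemma integrableOn_Ioc_of_laplace {f : ℝ → ℝ} {s : ℝ} (hs : 0 < s)
    (hf : IntegrableOn (fun x => Real.exp (-s * x) * f x) (Ioi 0)) (X : ℝ) :
    IntegrableOn f (Ioc 0 X) := by
  have h1 : IntegrableOn (fun x => Real.exp (s * x) * (Real.exp (-s * x) * f x)) (Ioc 0 X) := by
    refine Integrable.bdd_mul (c := Real.exp (s * X)) (hf.mono_set Ioc_subset_Ioi_self) ?_ ?_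
    · exact (by fun_prop : Continuous fun x => Real.exp (s * x)).aestronglyMeasurable
    · filter_upwards [ae_restrict_mem measurableSet_Ioc] with x hx
      rw [Real.norm_of_nonneg (Real.exp_pos _).le]
      exact Real.exp_le_exp.2 (mul_le_mul_of_nonneg_left hx.2 hs.le)
  refine h1.congr_fun (fun x _ => ?_) measurableSet_Ioc
  simp only
  rw [← mul_assoc, ← Real.exp_add]
  simp

lemma abs_weightedLaplace_sub_le {f g p : ℝ → ℝ} {s ε : ℝ} (hs : 0 < s)
    (hg : Continuous g) (hp : Continuous p) (hpos : ∀ x ∈ Ioi (0 : ℝ), 0 ≤ f x)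
    (hf : IntegrableOn (fun x => Real.exp (-s * x) * f x) (Ioi 0))
    (hε : ∀ t ∈ Icc (0 : ℝ) 1, |p t - g t| ≤ ε) :
    |weightedLaplace f p s - weightedLaplace f g s| ≤
      ε * ∫ x in Ioi (0 : ℝ), Real.exp (-s * x) * f x := by
  rw [weightedLaplace, weightedLaplace, ← integral_sub (integrableOn_weightedLaplace hs hp hf)
    (integrableOn_weightedLaplace hs hg hf), ← integral_const_mul, ← Real.norm_eq_abs]
  refine norm_integral_le_of_norm_le (hf.const_mul ε) ?_
  filter_upwards [ae_restrict_mem measurableSet_Ioi] with x hx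
  have h0 : 0 ≤ Real.exp (-s * x) * f x := mul_nonneg (Real.exp_pos _).le (hpos x hx)
  rw [← mul_sub, norm_mul, Real.norm_of_nonneg h0, mul_comm]
  exact mul_le_mul_of_nonneg_right (hε _ (exp_neg_mul_mem_Icc hs hx)) h0

lemma weightedLaplace_polynomial {f : ℝ → ℝ} {s : ℝ} (hs : 0 < s)
    (hf : IntegrableOn (fun x => Real.exp (-s * x) * f x) (Ioi 0)) (p : Polynomial ℝ) :
    weightedLaplace f (fun t => p.eval t) s = ∑ n ∈ Finset.range (p.natDegree + 1),
      p.coeff n * ∫ x in Ioi (0 : ℝ), Real.exp (-((n + 1) * s) * x) * f x := by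
  have key : ∀ (n : ℕ) (x : ℝ), Real.exp (-s * x) * f x * Real.exp (-s * x) ^ n =
      Real.exp (-((n + 1) * s) * x) * f x := by
    intro n x
    rw [mul_right_comm, ← Real.exp_nat_mul, ← Real.exp_add]
    congr 2
    ring
  have hint : ∀ n : ℕ, IntegrableOn (fun x => Real.exp (-((n + 1) * s) * x) * f x) (Ioi 0) := by
    intro n
    simpa only [key] using integrableOn_weightedLaplace hs (continuous_pow n) hf
  simp_rw [← integral_const_mul]
  rw [← integral_finsetSum _ fun n _ => (hint n).const_mul _, weightedLaplace]
  congr 1 with x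
  rw [Polynomial.eval_eq_sum_range, Finset.mul_sum]
  refine Finset.sum_congr rfl fun n _ => ?_
  rw [← key]
  ring

lemma tendsto_weightedLaplace_polynomial {f : ℝ → ℝ} {β γ : ℝ}
    (hf : ∀ s : ℝ, 0 < s → IntegrableOn (fun x => Real.exp (-s * x) * f x) (Ioi 0))
    (h : Tendsto (fun s : ℝ => s ^ β * ∫ x in Ioi (0 : ℝ), Real.exp (-s * x) * f x)
      (𝓝[>] 0) (𝓝 γ)) (p : Polynomial ℝ) :
    Tendsto (fun s : ℝ => s ^ β * weightedLaplace f (fun t => p.eval t) s) (𝓝[>] 0)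
      (𝓝 (∑ n ∈ Finset.range (p.natDegree + 1), p.coeff n * (((n : ℝ) + 1) ^ (-β) * γ))) := by
  have h1 : Tendsto (fun s : ℝ => ∑ n ∈ Finset.range (p.natDegree + 1), p.coeff n *
      (((n : ℝ) + 1) ^ (-β) * ((((n : ℝ) + 1) * s) ^ β *
        ∫ x in Ioi (0 : ℝ), Real.exp (-((n + 1) * s) * x) * f x))) (𝓝[>] 0)
      (𝓝 (∑ n ∈ Finset.range (p.natDegree + 1), p.coeff n * (((n : ℝ) + 1) ^ (-β) * γ))) := by
    refine tendsto_finsetSum _ fun n _ => ((h.comp ?_).const_mul _).const_mul _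
    have hn : (0 : ℝ) < n + 1 := by positivity
    refine tendsto_nhdsWithin_iff.2 ⟨?_, ?_⟩
    · refine tendsto_nhdsWithin_of_tendsto_nhds ?_
      simpa using (tendsto_id (α := ℝ) (x := 𝓝 0)).const_mul ((n : ℝ) + 1)
    · filter_upwards [self_mem_nhdsWithin] with s hs using mul_pos hn hs
  refine h1.congr' ?_
  filter_upwards [self_mem_nhdsWithin] with s hs
  have hs : 0 < s := hs
  rw [weightedLaplace_polynomial hs (hf s hs), Finset.mul_sum]
  refine Finset.sum_congr rfl fun n _ => ?_
  have hn : (0 : ℝ) < n + 1 := by positivity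
  have h2 : ((n : ℝ) + 1) ^ (-β) * ((n : ℝ) + 1) ^ β = 1 := by
    rw [← Real.rpow_add hn]; simp
  rw [Real.mul_rpow hn.le hs.le]
  linear_combination (p.coeff n * s ^ β *
    ∫ x in Ioi (0 : ℝ), Real.exp (-((n + 1) * s) * x) * f x) * h2

/-- If two nonnegative functions have Laplace transforms with the same power asymptotics, the
second one exactly, then so do all weighted Laplace transforms with continuous weight. -/
lemma tendsto_weightedLaplace {f f₀ g : ℝ → ℝ} {β γ : ℝ}
    (hpos : ∀ x ∈ Ioi (0 : ℝ), 0 ≤ f x) (hpos₀ : ∀ x ∈ Ioi (0 : ℝ), 0 ≤ f₀ x)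
    (hf : ∀ s : ℝ, 0 < s → IntegrableOn (fun x => Real.exp (-s * x) * f x) (Ioi 0))
    (hf₀ : ∀ s : ℝ, 0 < s → IntegrableOn (fun x => Real.exp (-s * x) * f₀ x) (Ioi 0))
    (h : Tendsto (fun s : ℝ => s ^ β * ∫ x in Ioi (0 : ℝ), Real.exp (-s * x) * f x)
      (𝓝[>] 0) (𝓝 γ))
    (h₀ : ∀ s : ℝ, 0 < s → ∫ x in Ioi (0 : ℝ), Real.exp (-s * x) * f₀ x = s ^ (-β) * γ)
    (hg : Continuous g) :
    Tendsto (fun s : ℝ => s ^ β * weightedLaplace f g s) (𝓝[>] 0)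
      (𝓝 (weightedLaplace f₀ g 1)) := by
  have hI₀ : ∫ x in Ioi (0 : ℝ), Real.exp (-1 * x) * f₀ x = γ := by simpa using h₀ 1 one_pos
  have hγ : 0 ≤ γ := by
    rw [← hI₀]
    exact setIntegral_nonneg measurableSet_Ioi fun x hx =>
      mul_nonneg (Real.exp_pos _).le (hpos₀ x hx)
  rw [Metric.tendsto_nhds]
  intro ε hε
  set δ := ε / (2 * (2 * γ + 2)) with hδ
  have hδ0 : 0 < δ := by positivity
  obtain ⟨p, hp⟩ := exists_polynomial_near_of_continuousOn 0 1 g hg.continuousOn δ hδ0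
  have hp' : ∀ t ∈ Icc (0 : ℝ) 1, |p.eval t - g t| ≤ δ := fun t ht => (hp t ht).le
  have h1 := tendsto_weightedLaplace_polynomial hf h p
  have h2 : weightedLaplace f₀ (fun t => p.eval t) 1 =
      ∑ n ∈ Finset.range (p.natDegree + 1), p.coeff n * (((n : ℝ) + 1) ^ (-β) * γ) := by
    rw [weightedLaplace_polynomial one_pos (hf₀ 1 one_pos)]
    refine Finset.sum_congr rfl fun n _ => ?_
    rw [mul_one, h₀ _ (by positivity)]
  rw [← h2, Metric.tendsto_nhds] at h1
  have h3 := abs_weightedLaplace_sub_le one_pos hg p.continuous hpos₀ (hf₀ 1 one_pos) hp'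
  rw [hI₀] at h3
  filter_upwards [h1 (ε / 2) (by positivity), h.eventually (gt_mem_nhds (lt_add_one γ)),
    self_mem_nhdsWithin] with s hs1 hs2 hs
  have hs : 0 < s := hs
  have h4 := abs_weightedLaplace_sub_le hs hg p.continuous hpos (hf s hs) hp'
  have hsβ : 0 < s ^ β := Real.rpow_pos_of_pos hs β
  have h5 : |s ^ β * weightedLaplace f (fun t => p.eval t) s - s ^ β * weightedLaplace f g s| ≤
      δ * (γ + 1) := by
    rw [← mul_sub, abs_mul, abs_of_pos hsβ]
    calc _ ≤ s ^ β * (δ * ∫ x in Ioi (0 : ℝ), Real.exp (-s * x) * f x) :=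
          mul_le_mul_of_nonneg_left h4 hsβ.le
      _ = δ * (s ^ β * ∫ x in Ioi (0 : ℝ), Real.exp (-s * x) * f x) := by ring
      _ ≤ _ := mul_le_mul_of_nonneg_left hs2.le hδ0.le
  rw [Real.dist_eq] at hs1 ⊢
  have h6 : δ * (γ + 1) + δ * γ < ε / 2 := by
    have : δ * (2 * γ + 2) = ε / 2 := by rw [hδ]; field_simp
    nlinarith
  rw [abs_lt] at hs1 ⊢
  rw [abs_le] at h3 h5
  constructor <;> linarith [h3.1, h3.2, h5.1, h5.2, hs1.1, hs1.2]

lemma setIntegral_Ioc_le_weightedLaplace {f g : ℝ → ℝ} {s B : ℝ} (hs : 0 < s)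
    (hpos : ∀ x ∈ Ioi (0 : ℝ), 0 ≤ f x)
    (hf : IntegrableOn (fun x => Real.exp (-s * x) * f x) (Ioi 0)) (hg : Continuous g)
    (hg0 : ∀ t, 0 ≤ g t) (hgB : ∀ y ≤ B, 1 ≤ Real.exp (-y) * g (Real.exp (-y))) :
    ∫ x in Ioc 0 (B / s), f x ≤ weightedLaplace f g s := by
  have hi := integrableOn_weightedLaplace hs hg hf
  refine (setIntegral_mono_on (integrableOn_Ioc_of_laplace hs hf _)
    (hi.mono_set Ioc_subset_Ioi_self) measurableSet_Ioc fun x hx => ?_).trans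
    (setIntegral_mono_set hi ?_ (ae_of_all _ fun x hx => Ioc_subset_Ioi_self hx))
  · have := hgB (s * x) (by rw [mul_comm]; exact (le_div_iff₀ hs).1 hx.2)
    have h0 := hpos x hx.1
    rw [neg_mul]
    nlinarith
  · filter_upwards [ae_restrict_mem measurableSet_Ioi] with x hx
    exact mul_nonneg (mul_nonneg (Real.exp_pos _).le (hpos x hx)) (hg0 _)

lemma weightedLaplace_le_setIntegral_Ioc {f g : ℝ → ℝ} {s A : ℝ} (hs : 0 < s)
    (hpos : ∀ x ∈ Ioi (0 : ℝ), 0 ≤ f x)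
    (hf : IntegrableOn (fun x => Real.exp (-s * x) * f x) (Ioi 0)) (hg : Continuous g)
    (hg1 : ∀ y, Real.exp (-y) * g (Real.exp (-y)) ≤ 1)
    (hgA : ∀ y, A < y → g (Real.exp (-y)) = 0) :
    weightedLaplace f g s ≤ ∫ x in Ioc 0 (A / s), f x := by
  have hi := integrableOn_weightedLaplace hs hg hf
  rw [weightedLaplace, setIntegral_eq_of_subset_of_forall_sdiff_eq_zero (s := Ioc 0 (A / s))
    measurableSet_Ioi Ioc_subset_Ioi_self]
  · refine setIntegral_mono_on (hi.mono_set Ioc_subset_Ioi_self)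
      (integrableOn_Ioc_of_laplace hs hf _) measurableSet_Ioc fun x hx => ?_
    have := hg1 (s * x)
    have h0 := hpos x hx.1
    rw [neg_mul]
    nlinarith
  · intro x hx
    have hx1 : A / s < x := by
      by_contra! hc
      exact hx.2 ⟨hx.1, hc⟩
    rw [neg_mul, hgA (s * x) (by rw [mul_comm]; exact (div_lt_iff₀ hs).1 hx1), mul_zero]

/-- A continuous weight `g` with `𝟙_{y ≤ 1} ≤ e^(-y) g(e^(-y)) ≤ 𝟙_{y ≤ r}`. -/
lemma exists_continuous_weight {r : ℝ} (hr : 1 < r) :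
    ∃ g : ℝ → ℝ, Continuous g ∧ (∀ t, 0 ≤ g t) ∧
      (∀ y ≤ 1, 1 ≤ Real.exp (-y) * g (Real.exp (-y))) ∧
      (∀ y, Real.exp (-y) * g (Real.exp (-y)) ≤ 1) ∧
      (∀ y, r < y → g (Real.exp (-y)) = 0) := by
  have ha : 0 < Real.exp (-r) := Real.exp_pos _
  have hab : 0 < Real.exp (-1) - Real.exp (-r) := sub_pos.2 (Real.exp_lt_exp.2 (by linarith))
  have hm : ∀ t, 0 < max t (Real.exp (-r)) := fun t => lt_max_of_lt_right ha
  refine ⟨fun t => min 1 (max 0 ((t - Real.exp (-r)) / (Real.exp (-1) - Real.exp (-r)))) /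
    max t (Real.exp (-r)), ?_, fun t => ?_, fun y hy => ?_, fun y => ?_, fun y hy => ?_⟩
  · exact Continuous.div (by fun_prop) (by fun_prop) fun t => (hm t).ne'
  · exact div_nonneg (le_min zero_le_one (le_max_left _ _)) (hm t).le
  · have h1 : Real.exp (-1) ≤ Real.exp (-y) := Real.exp_le_exp.2 (by linarith)
    have h2 : 1 ≤ (Real.exp (-y) - Real.exp (-r)) / (Real.exp (-1) - Real.exp (-r)) := by
      rw [le_div_iff₀ hab]; linarith
    simp only
    rw [min_eq_left (h2.trans (le_max_right _ _)), max_eq_left (by linarith),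
      mul_one_div_cancel (Real.exp_pos _).ne']
  · rw [← mul_div_assoc, div_le_one (hm _)]
    refine le_trans ?_ (le_max_left _ _)
    exact mul_le_of_le_one_right (Real.exp_pos _).le (min_le_left _ _)
  · have h1 : Real.exp (-y) < Real.exp (-r) := Real.exp_lt_exp.2 (by linarith)
    have h2 : (Real.exp (-y) - Real.exp (-r)) / (Real.exp (-1) - Real.exp (-r)) ≤ 0 :=
      div_nonpos_of_nonpos_of_nonneg (by linarith) hab.le
    simp only
    rw [max_eq_left h2, min_eq_right zero_le_one, zero_div]

lemma integral_exp_neg_mul_mul_rpow {β C : ℝ} (hβ : 0 < β) {s : ℝ} (hs : 0 < s) :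
    ∫ x in Ioi (0 : ℝ), Real.exp (-s * x) * (C * x ^ (β - 1)) =
      s ^ (-β) * (C * Real.Gamma β) := by
  have := Real.integral_rpow_mul_exp_neg_mul_Ioi hβ hs
  rw [one_div, Real.inv_rpow hs.le, ← Real.rpow_neg hs.le] at this
  calc _ = ∫ x in Ioi (0 : ℝ), C * (x ^ (β - 1) * Real.exp (-(s * x))) := by
        congr 1 with x
        rw [neg_mul]
        ring
    _ = _ := by
        rw [integral_const_mul, this]
        ring

lemma integrableOn_exp_neg_mul_mul_rpow {β C : ℝ} (hβ : 0 < β) {s : ℝ} (hs : 0 < s) :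
    IntegrableOn (fun x => Real.exp (-s * x) * (C * x ^ (β - 1))) (Ioi 0) := by
  have := (integrableOn_rpow_mul_exp_neg_mul_rpow (s := β - 1) (by linarith) one_pos hs).const_mul C
  refine this.congr (ae_of_all _ fun x => ?_)
  simp only [Real.rpow_one]
  ring

/-- The **Hardy–Littlewood–Karamata Tauberian theorem** for a nonnegative density and a pure
power. -/
theorem tendsto_setIntegral_Ioc_div_rpow_of_laplace {f : ℝ → ℝ} {β γ : ℝ} (hβ : 0 < β)
    (hγ : 0 ≤ γ) (hpos : ∀ x ∈ Ioi (0 : ℝ), 0 ≤ f x)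
    (hf : ∀ s : ℝ, 0 < s → IntegrableOn (fun x => Real.exp (-s * x) * f x) (Ioi 0))
    (h : Tendsto (fun s : ℝ => s ^ β * ∫ x in Ioi (0 : ℝ), Real.exp (-s * x) * f x)
      (𝓝[>] 0) (𝓝 γ)) :
    Tendsto (fun x : ℝ => (∫ t in Ioc 0 x, f t) / x ^ β) atTop (𝓝 (γ / Real.Gamma (β + 1))) := by
  have hΓ : 0 < Real.Gamma β := Real.Gamma_pos_of_pos hβ
  set C := γ / Real.Gamma (β + 1) with hC
  have hC' : γ / Real.Gamma β = C * β := by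
    rw [hC, Real.Gamma_add_one hβ.ne']; field_simp
  let f₀ : ℝ → ℝ := fun x => γ / Real.Gamma β * x ^ (β - 1)
  have hpos₀ : ∀ x ∈ Ioi (0 : ℝ), 0 ≤ f₀ x := fun x hx =>
    mul_nonneg (div_nonneg hγ hΓ.le) (Real.rpow_nonneg (le_of_lt hx) _)
  have hf₀ : ∀ s : ℝ, 0 < s → IntegrableOn (fun x => Real.exp (-s * x) * f₀ x) (Ioi 0) :=
    fun s hs => integrableOn_exp_neg_mul_mul_rpow hβ hs
  have hlap₀ : ∀ s : ℝ, 0 < s →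
      ∫ x in Ioi (0 : ℝ), Real.exp (-s * x) * f₀ x = s ^ (-β) * γ := fun s hs => by
    rw [integral_exp_neg_mul_mul_rpow hβ hs, div_mul_cancel₀ _ hΓ.ne']
  have hF₀ : ∀ X : ℝ, 0 ≤ X → ∫ x in Ioc 0 X, f₀ x = C * X ^ β := fun X hX => by
    rw [← intervalIntegral.integral_of_le hX, intervalIntegral.integral_const_mul,
      integral_rpow (Or.inl (by linarith)), hC', sub_add_cancel, Real.zero_rpow hβ.ne']
    field_simp
    ring
  have key : ∀ r : ℝ, 1 < r → ∃ K, C ≤ K ∧ K ≤ C * r ^ β ∧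
      (∀ u, K < u → ∀ᶠ x in atTop, (∫ t in Ioc 0 x, f t) / x ^ β < u) ∧
      (∀ u, u < K / r ^ β → ∀ᶠ x in atTop, u < (∫ t in Ioc 0 x, f t) / x ^ β) := by
    intro r hr
    have hr0 : 0 < r := by linarith
    have hrβ : 0 < r ^ β := Real.rpow_pos_of_pos hr0 β
    obtain ⟨g, hg, hg0, hgB, hg1, hgA⟩ := exists_continuous_weight hr
    have hT := tendsto_weightedLaplace hpos hpos₀ hf hf₀ h hlap₀ hg
    have hcomp : ∀ c : ℝ, 0 < c → Tendsto (fun x : ℝ => c / x) atTop (𝓝[>] 0) := fun c hc => by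
      refine tendsto_nhdsWithin_iff.2 ⟨tendsto_const_nhds.div_atTop tendsto_id, ?_⟩
      filter_upwards [eventually_gt_atTop 0] with x hx using div_pos hc hx
    refine ⟨weightedLaplace f₀ g 1, ?_, ?_, fun u hu => ?_, fun u hu => ?_⟩
    · have := setIntegral_Ioc_le_weightedLaplace one_pos hpos₀ (hf₀ 1 one_pos) hg hg0 hgB
      rwa [hF₀ _ (by norm_num), div_one, Real.one_rpow, mul_one] at this
    · have := weightedLaplace_le_setIntegral_Ioc one_pos hpos₀ (hf₀ 1 one_pos) hg hg1 hgA
      rwa [hF₀ _ (by positivity), div_one] at this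
    · filter_upwards [(hT.comp (hcomp 1 one_pos)).eventually (gt_mem_nhds hu),
        eventually_gt_atTop 0] with x hx hx0
      have hs : 0 < 1 / x := by positivity
      have := setIntegral_Ioc_le_weightedLaplace hs hpos (hf _ hs) hg hg0 hgB
      rw [one_div_one_div] at this
      refine lt_of_le_of_lt ?_ hx
      simp only [Function.comp]
      rw [Real.div_rpow zero_le_one hx0.le, Real.one_rpow, div_mul_eq_mul_div, one_mul]
      gcongr
    · rw [lt_div_iff₀ hrβ] at hu
      filter_upwards [(hT.comp (hcomp r hr0)).eventually (lt_mem_nhds hu),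
        eventually_gt_atTop 0] with x hx hx0
      have hs : 0 < r / x := by positivity
      have := weightedLaplace_le_setIntegral_Ioc hs hpos (hf _ hs) hg hg1 hgA
      rw [div_div_cancel₀ hr0.ne'] at this
      simp only [Function.comp] at hx
      have hxβ : 0 < x ^ β := Real.rpow_pos_of_pos hx0 β
      rw [Real.div_rpow hr0.le hx0.le, div_mul_eq_mul_div, lt_div_iff₀ hxβ] at hx
      rw [lt_div_iff₀ hxβ]
      refine lt_of_mul_lt_mul_left ?_ hrβ.le
      nlinarith [mul_le_mul_of_nonneg_left this hrβ.le]
  have hcont : Tendsto (fun r : ℝ => r ^ β) (𝓝[>] 1) (𝓝 1) := by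
    refine tendsto_nhdsWithin_of_tendsto_nhds ?_
    simpa using (Real.continuousAt_rpow_const 1 β (Or.inl one_ne_zero)).tendsto
  refine tendsto_order.2 ⟨fun u hu => ?_, fun u hu => ?_⟩
  · have h1 : Tendsto (fun r : ℝ => C / r ^ β) (𝓝[>] 1) (𝓝 C) := by
      simpa [Pi.div_def] using (tendsto_const_nhds (x := C)).div hcont one_ne_zero
    obtain ⟨r, hr, hr1⟩ := ((h1.eventually (lt_mem_nhds hu)).and self_mem_nhdsWithin).exists
    obtain ⟨K, hK, -, -, hlow⟩ := key r hr1
    have hrβ : 0 < r ^ β := Real.rpow_pos_of_pos (one_pos.trans hr1) β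
    exact hlow u (hr.trans_le (by gcongr))
  · have h1 : Tendsto (fun r : ℝ => C * r ^ β) (𝓝[>] 1) (𝓝 C) := by
      simpa using hcont.const_mul C
    obtain ⟨r, hr, hr1⟩ := ((h1.eventually (gt_mem_nhds hu)).and self_mem_nhdsWithin).exists
    obtain ⟨K, -, hK, hup, -⟩ := key r hr1
    exact hup u (hK.trans_lt hr)


/-- Tauberian theorem: if `f ≥ 0` vanishes on `(-∞,0)` and its Laplace transform
satisfies `s^(α+k+1) ∫₀^∞ e^(-sx) f(x) dx → γ` as `s → 0⁺`, then
`Γ(α+k+2) (∫₀ˣ f)/x^(α+k+1) → γ` as `x → ∞`, i.e. `W = f/H^k` satisfies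
`W(x) ∼ γ x^α/Γ(α+1) (C)`. -/
theorem stmt19 (f : ℝ → ℝ) (hf : Continuous f) (hf0 : ∀ x : ℝ, x < 0 → f x = 0)
    (hfpos : ∀ x : ℝ, 0 ≤ f x)
    (k : ℕ) (hk : 1 ≤ k) (α : ℝ) (hα : -1 < α) (γ : ℝ) (hγ : 0 ≤ γ)
    (hint : ∀ s : ℝ, 0 < s →
      MeasureTheory.IntegrableOn (fun x : ℝ => Real.exp (-s * x) * f x) (Set.Ioi 0))
    (h : Filter.Tendsto
      (fun s : ℝ => s ^ (α + k + 1) * ∫ x in Set.Ioi (0:ℝ), Real.exp (-s * x) * f x)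
      (nhdsWithin 0 (Set.Ioi 0)) (nhds γ)) :
    Filter.Tendsto
      (fun x : ℝ => Real.Gamma (α + k + 2) * (∫ t in (0:ℝ)..x, f t) / x ^ (α + k + 1))
      Filter.atTop (nhds γ) := by
  have hβ : 0 < α + k + 1 := by
    have : (0 : ℝ) ≤ k := Nat.cast_nonneg k
    linarith
  have hΓ : Real.Gamma (α + k + 1 + 1) ≠ 0 := (Real.Gamma_pos_of_pos (by linarith)).ne'
  have := (tendsto_setIntegral_Ioc_div_rpow_of_laplace hβ hγ (fun x _ => hfpos x) hint h).const_mul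
    (Real.Gamma (α + k + 1 + 1))
  rw [mul_div_cancel₀ _ hΓ] at this
  refine this.congr' ?_
  filter_upwards [eventually_ge_atTop 0] with x hx
  rw [intervalIntegral.integral_of_le hx, mul_div_assoc, add_assoc (α + k) 1 1, one_add_one_eq_two]
end
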